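/- arXiv:1303.4065 — 7 statements merged into one kernel-verified Lean document; each statement's English description precedes it below -/
import Mathlib

section
/- For all integers k and t with k > t ≥ 2 there exist reals ε > 0 and C > 0 and an integer n₀ such that for every n ≥ n₀ there is a family 𝓕 of k-element subsets of an n-element set X in which every t-element subset of X is contained in at most one member of 𝓕, and such that for every integer ℓ with 0 ≤ ℓ < t and every ℓ-element subset X' of X, the number of t-element subsets of X that contain X' and are contained in no member of 𝓕 is at most C · n^{t-ℓ-ε}. -/
open Finset

theorem sum_exp_le_card {β : Type*} (E : Finset β) (y : β → ℝ) {b x τ e lam s : ℝ}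
    (hs : s = 1 ∨ s = -1) (hy0 : ∀ f ∈ E, 0 ≤ y f) (hyb : ∀ f ∈ E, y f ≤ b)
    (hx0 : 0 ≤ x) (hx2 : x ≤ 2) (hτ0 : 0 ≤ τ) (hτ : τ ≤ 1 / 2) (he0 : 0 < e) (he : e ≤ 1 / 3)
    (hlam : 0 < lam) (hsmall : lam * 1000 * (b + τ) ≤ e)
    (hmean : |∑ f ∈ E, y f - τ * x * #E| ≤ 3 * e * (τ * x * #E)) :
    ∑ f ∈ E, Real.exp (lam * (s * ((τ * x - y f) / (1 - τ)) - 14 * τ * e)) ≤ #E := by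
  rcases E.eq_empty_or_nonempty with rfl | ⟨f₀, hf₀⟩
  · simp
  have hb : 0 ≤ b := (hy0 f₀ hf₀).trans (hyb f₀ hf₀)
  set m : ℝ := (#E : ℝ) with hm
  have hm0 : 0 ≤ m := by positivity
  set c : ℝ := 1 / (1 - τ) with hc
  have hc1 : 0 ≤ c := by apply div_nonneg <;> linarith
  have hc2 : c ≤ 2 := by rw [hc, div_le_iff₀ (by linarith)]; linarith
  set u : β → ℝ := fun f => c * (τ * x - y f) with hu
  set z : β → ℝ := fun f => lam * (s * u f - 14 * τ * e) with hz
  have hs2 : s ^ 2 = 1 := by rcases hs with rfl | rfl <;> norm_num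
  have hτx : 0 ≤ τ * x := by positivity
  have hτx2 : τ * x ≤ 2 * τ := by nlinarith
  have hS := abs_le.1 hmean
  have hu_sq : ∀ f ∈ E, u f ^ 2 ≤ 4 * (4 * τ ^ 2 + b * y f) := by
    intro f hf
    have h1 : (τ * x - y f) ^ 2 ≤ 4 * τ ^ 2 + b * y f := by
      nlinarith [hy0 f hf, hyb f hf, mul_nonneg hτx (hy0 f hf),
        mul_nonneg (hy0 f hf) (sub_nonneg.2 (hyb f hf))]
    have h2 : c ^ 2 ≤ 4 := by nlinarith
    simp only [hu, mul_pow]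
    exact mul_le_mul h2 h1 (sq_nonneg _) (by norm_num)
  have hu_abs : ∀ f ∈ E, |u f| ≤ 4 * (b + τ) := by
    intro f hf
    rw [hu, abs_mul, abs_of_nonneg hc1]
    have : |τ * x - y f| ≤ 2 * (b + τ) := by
      rw [abs_le]; constructor <;> linarith [hy0 f hf, hyb f hf]
    nlinarith [abs_nonneg (τ * x - y f)]
  have hs_abs : |s| = 1 := by rcases hs with rfl | rfl <;> norm_num
  have hlτ : lam * τ ≤ e / 1000 := by nlinarith [mul_nonneg hlam.le hb]
  have hlb : lam * (b + τ) ≤ e / 1000 := by linarith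
  have hz_abs : ∀ f ∈ E, |z f| ≤ 1 := by
    intro f hf
    have h1 : |s * u f - 14 * τ * e| ≤ 4 * (b + τ) + 14 * τ * e := by
      refine (abs_sub _ _).trans ?_
      rw [abs_mul, hs_abs, one_mul, abs_of_nonneg (by positivity : 0 ≤ 14 * τ * e)]
      linarith [hu_abs f hf]
    rw [hz, abs_mul, abs_of_pos hlam]
    have h2 : lam * (14 * τ * e) ≤ 14 * (e / 1000) * e := by nlinarith
    calc lam * |s * u f - 14 * τ * e| ≤ lam * (4 * (b + τ) + 14 * τ * e) := by gcongr
      _ = 4 * (lam * (b + τ)) + lam * (14 * τ * e) := by ring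
      _ ≤ 4 * (e / 1000) + 14 * (e / 1000) * e := by linarith
      _ ≤ 1 := by nlinarith
  have hexp : ∀ f ∈ E, Real.exp (z f) ≤ 1 + z f + z f ^ 2 := by
    intro f hf
    linarith [(abs_le.1 (Real.abs_exp_sub_one_sub_id_le (hz_abs f hf))).2]
  have hz_sq : ∀ f ∈ E, z f ^ 2 ≤
      2 * lam ^ 2 * (4 * (4 * τ ^ 2 + b * y f) + 196 * τ ^ 2 * e ^ 2) := by
    intro f hf
    have h1 : (s * u f - 14 * τ * e) ^ 2 ≤ 2 * (u f ^ 2 + 196 * τ ^ 2 * e ^ 2) := by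
      nlinarith [sq_nonneg (s * u f + 14 * τ * e)]
    have h2 := hu_sq f hf
    rw [hz, mul_pow]
    nlinarith [sq_nonneg lam]
  have hsum_z : ∑ f ∈ E, z f ≤ lam * (-2 * τ * e) * m := by
    have h1 : ∑ f ∈ E, z f = lam * (s * (c * (τ * x * m - ∑ f ∈ E, y f)) - 14 * τ * e * m) := by
      simp only [hz, hu, ← mul_sum, sum_sub_distrib, sum_const, nsmul_eq_mul, ← hm]
      ring
    have h2 : s * (c * (τ * x * m - ∑ f ∈ E, y f)) ≤ 12 * τ * e * m := by
      refine (le_abs_self _).trans ?_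
      rw [abs_mul, hs_abs, one_mul, abs_mul, abs_of_nonneg hc1, abs_sub_comm]
      have h3 : 3 * e * (τ * x * m) ≤ 3 * e * (2 * τ * m) := by gcongr
      calc _ ≤ 2 * (3 * e * (2 * τ * m)) :=
            mul_le_mul hc2 (hmean.trans h3) (abs_nonneg _) (by norm_num)
        _ = _ := by ring
    rw [h1, show lam * (-2 * τ * e) * m = lam * (-2 * τ * e * m) by ring]
    refine mul_le_mul_of_nonneg_left ?_ hlam.le
    linarith
  have hsum_y : ∑ f ∈ E, y f ≤ 4 * τ * m := by
    have : τ * x * m ≤ 2 * τ * m := by gcongr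
    nlinarith [mul_nonneg hτx hm0]
  have hsum_sq : ∑ f ∈ E, z f ^ 2 ≤
      2 * lam ^ 2 * (16 * τ * (b + τ) + 196 * τ ^ 2 * e ^ 2) * m := by
    calc _ ≤ ∑ f ∈ E, 2 * lam ^ 2 * (4 * (4 * τ ^ 2 + b * y f) + 196 * τ ^ 2 * e ^ 2) :=
          sum_le_sum hz_sq
      _ = 2 * lam ^ 2 * (16 * τ ^ 2 * m + 4 * b * ∑ f ∈ E, y f + 196 * τ ^ 2 * e ^ 2 * m) := by
          simp only [← mul_sum, sum_add_distrib, sum_const, nsmul_eq_mul, ← hm]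
          ring
      _ ≤ 2 * lam ^ 2 * (16 * τ ^ 2 * m + 4 * b * (4 * τ * m) + 196 * τ ^ 2 * e ^ 2 * m) := by
          gcongr
      _ = _ := by ring
  clear_value z u c m
  have hfin : 2 * lam ^ 2 * (16 * τ * (b + τ) + 196 * τ ^ 2 * e ^ 2) ≤ lam * (2 * τ * e) := by
    have h1 : 32 * (lam * (b + τ)) ≤ 32 * (e / 1000) := by linarith
    have h2 : 392 * (lam * τ) * e ^ 2 ≤ 392 * (e / 1000) * (1 / 9) := by
      gcongr
      nlinarith
    calc _ = lam * τ * (32 * (lam * (b + τ)) + 392 * (lam * τ) * e ^ 2) := by ring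
      _ ≤ lam * τ * (2 * e) := by
          gcongr
          linarith
      _ = _ := by ring
  have hfin' := mul_le_mul_of_nonneg_right hfin hm0
  calc ∑ f ∈ E, Real.exp (lam * (s * ((τ * x - y f) / (1 - τ)) - 14 * τ * e))
      = ∑ f ∈ E, Real.exp (z f) := by
        refine sum_congr rfl fun f _ => ?_
        rw [hz, hu, hc]
        congr 4
        ring
    _ ≤ ∑ f ∈ E, (1 + z f + z f ^ 2) := sum_le_sum hexp
    _ = m + ∑ f ∈ E, z f + ∑ f ∈ E, z f ^ 2 := by
        simp only [sum_add_distrib, sum_const, nsmul_eq_mul, ← hm, mul_one]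
    _ ≤ m := by linarith

theorem sum_exp_le_card_mul {β : Type*} (E : Finset β) (h : β → ℝ) {H a Q τ e e' lam s : ℝ}
    (hs : s = 1 ∨ s = -1) (h0 : ∀ f ∈ E, 0 ≤ h f) (hH : ∀ f ∈ E, h f ≤ H)
    (ha : 0 ≤ a) (haQ : a ≤ 2 * Q) (hQ : 0 < Q) (hτ0 : 0 ≤ τ) (hτ : τ ≤ 1 / 2)
    (he0 : 0 < e) (he : e ≤ 1 / 3) (hlam : 0 < lam) (hsmall : lam * 1000 * (H / Q + τ) ≤ e)
    (hmean : |∑ f ∈ E, h f - τ * a * #E| ≤ 3 * e * (τ * a * #E))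
    (he' : e + 14 * τ * e ≤ e') :
    ∑ f ∈ E, Real.exp (lam * (s * ((a - h f) / (Q * (1 - τ)) - 1) - e')) ≤
      #E * Real.exp (lam * (s * (a / Q - 1) - e)) := by
  have key := sum_exp_le_card E (fun f => h f / Q) (b := H / Q) (x := a / Q) hs
    (fun f hf => div_nonneg (h0 f hf) hQ.le)
    (fun f hf => div_le_div_of_nonneg_right (hH f hf) hQ.le) (by positivity)
    (by rwa [div_le_iff₀ hQ]) hτ0 hτ he0 he hlam hsmall
    (by
      have h1 : ∑ f ∈ E, h f / Q - τ * (a / Q) * #E = (∑ f ∈ E, h f - τ * a * #E) / Q := by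
        rw [← sum_div]; ring
      rw [h1, abs_div, abs_of_pos hQ, div_le_iff₀ hQ]
      have h2 : 3 * e * (τ * (a / Q) * #E) * Q = 3 * e * (τ * a * #E) * (Q / Q) := by ring
      rwa [h2, div_self hQ.ne', mul_one])
  rw [mul_comm (#E : ℝ)]
  refine le_trans ?_ (mul_le_mul_of_nonneg_left key (Real.exp_pos _).le)
  rw [mul_sum]
  refine sum_le_sum fun f _ => ?_
  rw [← Real.exp_add, Real.exp_le_exp, ← mul_add]
  refine mul_le_mul_of_nonneg_left ?_ hlam.le
  have h1 : 1 - τ ≠ 0 := by linarith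
  have h2 : (a - h f) / (Q * (1 - τ)) = a / Q + (τ * (a / Q) - h f / Q) / (1 - τ) := by
    field_simp
    ring
  rw [h2]
  linarith

theorem abs_sub_le_of_ratio_bounds {S a c G m r P e : ℝ} (ha : 0 ≤ a) (hc : 0 ≤ c) 
    (hP : 0 < P) (hG : 0 < G) (he0 : 0 < e) (he : e ≤ 1 / 3)
    (hS1 : a * c * (G * (1 - 2 * e)) ≤ S) (hS2 : S ≤ a * c * (G * (1 + e)))
    (hm1 : P * (G * (1 - e)) ≤ m * r) (hm2 : m * r ≤ P * (G * (1 + e))) :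
    |S - c * r / P * a * m| ≤ 3 * e * (c * r / P * a * m) := by
  set w := m * r / P with hw
  have hw1 : G * (1 - e) ≤ w := by rw [hw, le_div_iff₀ hP]; linarith
  have hw2 : w ≤ G * (1 + e) := by rw [hw, div_le_iff₀ hP]; linarith
  have h1 : c * r / P * a * m = a * c * w := by rw [hw]; ring
  rw [h1, abs_le]
  have hac := mul_nonneg ha hc
  constructor
  · have : w * (1 - 3 * e) ≤ G * (1 - 2 * e) := by nlinarith [mul_pos hG he0, mul_pos (mul_pos hG he0) he0]
    nlinarith
  · have : G * (1 + e) ≤ w * (1 + 3 * e) := by nlinarith [mul_pos hG he0, mul_pos (mul_pos hG he0) he0]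
    nlinarith

section Matching

variable {V β ι : Type*} [DecidableEq V]

/-- The edges all of whose vertices lie in `A`. -/
def avail (E : Finset β) (supp : β → Finset V) (A : Finset V) : Finset β :=
  {e ∈ E | supp e ⊆ A}

/-- The number of edges inside `A` that contain the vertex `v`. -/
def deg (E : Finset β) (supp : β → Finset V) (A : Finset V) (v : V) : ℕ :=
  #{e ∈ avail E supp A | v ∈ supp e}

/-- The number of edges inside `A` at `v` that are destroyed when `f` is removed,
with value `0` when `f` itself contains `v`. -/
def hits (E : Finset β) (supp : β → Finset V) (A : Finset V) (v : V) (f : β) : ℕ :=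
  #{e ∈ avail E supp A | v ∈ supp e ∧ v ∉ supp f ∧ ¬Disjoint (supp e) (supp f)}

variable {E : Finset β} {supp : β → Finset V} {A : Finset V}

theorem mem_avail {e : β} : e ∈ avail E supp A ↔ e ∈ E ∧ supp e ⊆ A := by
  simp [avail]

theorem deg_sdiff_add_hits {v : V} {f : β} (hv : v ∉ supp f) :
    deg E supp (A \ supp f) v + hits E supp A v f = deg E supp A v := by
  unfold deg hits
  rw [← card_filter_add_card_filter_not (s := {e ∈ avail E supp A | v ∈ supp e})
    (fun e => Disjoint (supp e) (supp f))]
  congr 2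
  · ext e
    simp only [mem_filter, mem_avail, subset_sdiff]
    tauto
  · ext e
    simp only [mem_filter]
    tauto

theorem sum_deg (B : Finset V) :
    ∑ u ∈ B, deg E supp A u = ∑ e ∈ avail E supp A, #(supp e ∩ B) := by
  unfold deg
  have := sum_card_bipartiteAbove_eq_sum_card_bipartiteBelow (s := B) (t := avail E supp A)
    (fun u e => u ∈ supp e)
  simp only [bipartiteAbove, bipartiteBelow] at this
  refine this.trans ?_
  · refine sum_congr rfl fun e _ => ?_
    congr 1
    ext u
    simp [and_comm]

theorem codeg_avail_le {κ : ℕ}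
    (hκ : ∀ u v : V, u ≠ v → #{e ∈ E | u ∈ supp e ∧ v ∈ supp e} ≤ κ) {u v : V} (huv : u ≠ v) :
    #{e ∈ avail E supp A | u ∈ supp e ∧ v ∈ supp e} ≤ κ :=
  (card_le_card (filter_subset_filter _ (filter_subset _ _))).trans (hκ u v huv)

theorem hits_le {κ r : ℕ} (hr : ∀ e ∈ E, #(supp e) = r)
    (hκ : ∀ u v : V, u ≠ v → #{e ∈ E | u ∈ supp e ∧ v ∈ supp e} ≤ κ) (v : V) {f : β}
    (hf : f ∈ E) : hits E supp A v f ≤ r * κ := by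
  classical
  by_cases hv : v ∈ supp f
  · simp [hits, hv]
  calc hits E supp A v f
      ≤ #((supp f).biUnion fun u => {e ∈ avail E supp A | v ∈ supp e ∧ u ∈ supp e}) := by
        refine card_le_card fun e he => ?_
        simp only [mem_filter, not_disjoint_iff] at he
        obtain ⟨he, hve, -, u, hu, hu'⟩ := he
        simp only [mem_biUnion, mem_filter]
        exact ⟨u, hu', he, hve, hu⟩
    _ ≤ #(supp f) * κ := card_biUnion_le_card_mul _ _ _ fun u hu =>
        codeg_avail_le hκ (ne_of_mem_of_not_mem hu hv).symm
    _ = r * κ := by rw [hr f hf]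

theorem sum_hits (v : V) :
    ∑ f ∈ avail E supp A, hits E supp A v f = ∑ e ∈ avail E supp A with v ∈ supp e,
      #{f ∈ avail E supp A | v ∉ supp f ∧ ¬Disjoint (supp e) (supp f)} := by
  have := sum_card_bipartiteAbove_eq_sum_card_bipartiteBelow
    (s := {e ∈ avail E supp A | v ∈ supp e}) (t := avail E supp A)
    (fun e f => v ∉ supp f ∧ ¬Disjoint (supp e) (supp f))
  simp only [bipartiteAbove, bipartiteBelow] at this
  rw [this]
  refine sum_congr rfl fun f _ => ?_
  rw [filter_filter]
  rfl

theorem card_hitting_le (v : V) (e : β) :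
    #{f ∈ avail E supp A | v ∉ supp f ∧ ¬Disjoint (supp e) (supp f)} ≤
      ∑ u ∈ (supp e).erase v, deg E supp A u := by
  classical
  refine le_trans (card_le_card fun f hf => ?_)
    (card_biUnion_le (s := (supp e).erase v) (t := fun u => {f ∈ avail E supp A | u ∈ supp f}))
  simp only [mem_filter, not_disjoint_iff] at hf
  obtain ⟨hf, hv, u, hu, hu'⟩ := hf
  simp only [mem_biUnion, mem_filter, mem_erase]
  exact ⟨u, ⟨ne_of_mem_of_not_mem hu' hv, hu⟩, hf, hu'⟩

theorem sum_deg_le_card_hitting {κ r : ℕ} (hr : ∀ e ∈ E, #(supp e) = r)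
    (hκ : ∀ u v : V, u ≠ v → #{e ∈ E | u ∈ supp e ∧ v ∈ supp e} ≤ κ) {v : V} {e : β}
    (he : e ∈ E) (hv : v ∈ supp e) :
    ∑ u ∈ (supp e).erase v, deg E supp A u ≤
      #{f ∈ avail E supp A | v ∉ supp f ∧ ¬Disjoint (supp e) (supp f)} +
        (r - 1) * (r * κ) := by
  classical
  set T : V → Finset β := fun u => {f ∈ avail E supp A | supp e ∩ supp f = {u}} with hT
  have h1 : ∀ u ∈ (supp e).erase v, deg E supp A u ≤ #(T u) + r * κ := by
    intro u hu
    have hsub : {f ∈ avail E supp A | u ∈ supp f} ⊆ T u ∪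
        ((supp e).erase u).biUnion fun w => {f ∈ avail E supp A | u ∈ supp f ∧ w ∈ supp f} := by
      intro f hf
      simp only [mem_filter] at hf
      by_cases hfu : supp e ∩ supp f = {u}
      · exact mem_union_left _ (by simp [hT, hf.1, hfu])
      · refine mem_union_right _ ?_
        have : ∃ w ∈ supp e ∩ supp f, w ≠ u := by
          by_contra! hcon
          refine hfu (eq_singleton_iff_unique_mem.2 ⟨?_, hcon⟩)
          exact mem_inter.2 ⟨mem_of_mem_erase hu, hf.2⟩
        obtain ⟨w, hw, hwu⟩ := this
        simp only [mem_inter] at hw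
        simp only [mem_biUnion, mem_filter, mem_erase]
        exact ⟨w, ⟨hwu, hw.1⟩, hf.1, hf.2, hw.2⟩
    refine (card_le_card hsub).trans ((card_union_le _ _).trans ?_)
    gcongr
    refine (card_biUnion_le_card_mul _ _ κ fun w hw =>
      codeg_avail_le hκ (ne_of_mem_erase hw).symm).trans ?_
    gcongr
    rw [← hr e he]
    exact card_erase_le
  have h2 : ∑ u ∈ (supp e).erase v, #(T u) ≤
      #{f ∈ avail E supp A | v ∉ supp f ∧ ¬Disjoint (supp e) (supp f)} := by
    rw [← card_biUnion]
    · refine card_le_card fun f hf => ?_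
      simp only [hT, mem_biUnion, mem_filter, mem_erase] at hf
      obtain ⟨u, ⟨huv, hu⟩, hf, hfu⟩ := hf
      have huf : u ∈ supp e ∩ supp f := by simp [hfu]
      refine mem_filter.2 ⟨hf, fun hvf => huv ?_, ?_⟩
      · have : v ∈ supp e ∩ supp f := mem_inter.2 ⟨hv, hvf⟩
        rw [hfu, mem_singleton] at this
        exact this.symm
      · exact not_disjoint_iff.2 ⟨u, mem_inter.1 huf⟩
    · intro u _ w _ huw
      refine disjoint_left.2 fun f hf hf' => huw ?_
      simp only [hT, mem_filter] at hf hf'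
      exact singleton_injective (hf.2.symm.trans hf'.2)
  calc ∑ u ∈ (supp e).erase v, deg E supp A u
      ≤ ∑ u ∈ (supp e).erase v, (#(T u) + r * κ) := sum_le_sum h1
    _ = ∑ u ∈ (supp e).erase v, #(T u) + (r - 1) * (r * κ) := by
        rw [sum_add_distrib, sum_const, card_erase_of_mem hv, hr e he, smul_eq_mul]
    _ ≤ _ := by gcongr

/-- The exponential potential controlling the degrees of the remaining vertices (relative to the
target `G`) and the sizes of the remaining parts of the test sets (relative to the target
proportion `p`), with relative error `e`. -/
noncomputable def potential (E : Finset β) (supp : β → Finset V) (J : Finset ι) (W : ι → Finset V)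
    (lam : ℝ) (A : Finset V) (G p e : ℝ) : ℝ :=
  ∑ v ∈ A, (Real.exp (lam * (1 * (deg E supp A v / G - 1) - e)) +
    Real.exp (lam * (-1 * (deg E supp A v / G - 1) - e))) +
  ∑ j ∈ J, Real.exp (lam * (1 * (#(W j ∩ A) / (#(W j) * p) - 1) - e))

variable {J : Finset ι} {W : ι → Finset V} {lam G p e : ℝ}

theorem deg_bounds_of_potential_lt_one (hlam : 0 < lam) (hG : 0 < G)
    (h : potential E supp J W lam A G p e < 1) {v : V} (hv : v ∈ A) :
    G * (1 - e) ≤ deg E supp A v ∧ deg E supp A v ≤ G * (1 + e) := by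
  have hJ : 0 ≤ ∑ j ∈ J, Real.exp (lam * (1 * (#(W j ∩ A) / (#(W j) * p) - 1) - e)) :=
    sum_nonneg fun _ _ => (Real.exp_pos _).le
  have h1 := single_le_sum (s := A)
    (f := fun v => Real.exp (lam * (1 * (deg E supp A v / G - 1) - e)) +
      Real.exp (lam * (-1 * (deg E supp A v / G - 1) - e))) (fun _ _ => by positivity) hv
  have h2 : Real.exp (lam * (1 * (deg E supp A v / G - 1) - e)) +
      Real.exp (lam * (-1 * (deg E supp A v / G - 1) - e)) < 1 := by
    unfold potential at h
    exact lt_of_le_of_lt (by linarith) h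
  have h3 : Real.exp (lam * (1 * (deg E supp A v / G - 1) - e)) < 1 := by
    linarith [Real.exp_pos (lam * (-1 * (deg E supp A v / G - 1) - e))]
  have h4 : Real.exp (lam * (-1 * (deg E supp A v / G - 1) - e)) < 1 := by
    linarith [Real.exp_pos (lam * (1 * (deg E supp A v / G - 1) - e))]
  rw [Real.exp_lt_one_iff, mul_neg_iff] at h3 h4
  have h5 : (deg E supp A v : ℝ) / G ≤ 1 + e := by
    rcases h3 with h3 | h3 <;> linarith
  have h6 : 1 - e ≤ (deg E supp A v : ℝ) / G := by
    rcases h4 with h4 | h4 <;> linarith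
  rw [div_le_iff₀ hG] at h5
  rw [le_div_iff₀ hG] at h6
  constructor <;> linarith

theorem card_inter_le_of_potential_lt_one (hlam : 0 < lam) (hp : 0 < p)
    (h : potential E supp J W lam A G p e < 1) {j : ι} (hj : j ∈ J) (hW : 0 < #(W j)) :
    (#(W j ∩ A) : ℝ) ≤ #(W j) * p * (1 + e) := by
  have hA : 0 ≤ ∑ v ∈ A, (Real.exp (lam * (1 * (deg E supp A v / G - 1) - e)) +
      Real.exp (lam * (-1 * (deg E supp A v / G - 1) - e))) :=
    sum_nonneg fun _ _ => by positivity
  have h1 := single_le_sum (s := J)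
    (f := fun j => Real.exp (lam * (1 * (#(W j ∩ A) / (#(W j) * p) - 1) - e)))
    (fun _ _ => by positivity) hj
  have h3 : Real.exp (lam * (1 * (#(W j ∩ A) / (#(W j) * p) - 1) - e)) < 1 := by
    unfold potential at h
    exact lt_of_le_of_lt (by linarith) h
  rw [Real.exp_lt_one_iff, mul_neg_iff] at h3
  have h5 : (#(W j ∩ A) : ℝ) / (#(W j) * p) ≤ 1 + e := by
    rcases h3 with h3 | h3 <;> linarith
  rw [div_le_iff₀ (by positivity)] at h5
  linarith

theorem card_avail_bounds {r : ℕ} (hr : ∀ e ∈ E, #(supp e) = r)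
    (hdeg : ∀ v ∈ A, G * (1 - e) ≤ deg E supp A v ∧ deg E supp A v ≤ G * (1 + e)) :
    (#A : ℝ) * (G * (1 - e)) ≤ #(avail E supp A) * r ∧
      (#(avail E supp A) : ℝ) * r ≤ #A * (G * (1 + e)) := by
  have h1 : ∑ u ∈ A, (deg E supp A u : ℝ) = #(avail E supp A) * r := by
    have h2 : ∑ f ∈ avail E supp A, #(supp f ∩ A) = #(avail E supp A) * r := by
      rw [sum_const_nat fun f hf => ?_]
      rw [inter_eq_left.2 (mem_avail.1 hf).2, hr f (mem_avail.1 hf).1]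
    exact_mod_cast (sum_deg A).trans h2
  rw [← h1, ← nsmul_eq_mul, ← nsmul_eq_mul]
  exact ⟨card_nsmul_le_sum _ _ _ fun v hv => (hdeg v hv).1,
    sum_le_card_nsmul _ _ _ fun v hv => (hdeg v hv).2⟩

theorem sum_exp_deg_le {κ r : ℕ} (hr : ∀ e ∈ E, #(supp e) = r) (hr1 : 1 ≤ r)
    (hκ : ∀ u v : V, u ≠ v → #{e ∈ E | u ∈ supp e ∧ v ∈ supp e} ≤ κ)
    {e' s τ : ℝ} (hs : s = 1 ∨ s = -1) (hlam : 0 < lam) (hG : 0 < G) (he0 : 0 < e)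
    (he : e ≤ 1 / 3) (hA : 0 < #A) (hτ : τ = (r - 1) * r / #A) (hτ2 : τ ≤ 1 / 2)
    (hdeg : ∀ v ∈ A, G * (1 - e) ≤ deg E supp A v ∧ deg E supp A v ≤ G * (1 + e))
    (hκe : r * κ ≤ e * G) (hsmall : lam * 1000 * (r * κ / G + τ) ≤ e)
    (he' : e + 14 * τ * e ≤ e') {v : V} (hv : v ∈ A) :
    ∑ f ∈ avail E supp A with v ∉ supp f,
      Real.exp (lam * (s * (deg E supp (A \ supp f) v / (G * (1 - τ)) - 1) - e')) ≤
    #(avail E supp A) * Real.exp (lam * (s * (deg E supp A v / G - 1) - e)) := by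
  have hA' : (0 : ℝ) < #A := by exact_mod_cast hA
  have hr1' : (0 : ℝ) ≤ r - 1 := by
    have : (1 : ℝ) ≤ r := by exact_mod_cast hr1
    linarith
  have hτ0 : 0 ≤ τ := by rw [hτ]; positivity
  have hcast : ((r - 1 : ℕ) : ℝ) = r - 1 := by push_cast [hr1]; ring
  obtain ⟨hm1, hm2⟩ := card_avail_bounds hr hdeg
  set S : ℝ := ∑ f ∈ avail E supp A, (hits E supp A v f : ℝ) with hS
  have hSeq : S = ∑ e ∈ avail E supp A with v ∈ supp e,
      (#{f ∈ avail E supp A | v ∉ supp f ∧ ¬Disjoint (supp e) (supp f)} : ℝ) := by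
    rw [hS]
    exact_mod_cast sum_hits (E := E) (supp := supp) (A := A) v
  have hcard : ∀ e ∈ ({e ∈ avail E supp A | v ∈ supp e} : Finset β),
      ((#((supp e).erase v) : ℕ) : ℝ) = r - 1 ∧ e ∈ E ∧ v ∈ supp e ∧ supp e ⊆ A := by
    intro e he
    simp only [mem_filter, mem_avail] at he
    exact ⟨by rw [card_erase_of_mem he.2, hr e he.1.1, hcast], he.1.1, he.2, he.1.2⟩
  have hS2 : S ≤ deg E supp A v * (r - 1) * (G * (1 + e)) := by
    rw [hSeq, mul_assoc, deg, ← nsmul_eq_mul]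
    refine sum_le_card_nsmul _ _ _ fun e he => ?_
    obtain ⟨hc, -, -, heA⟩ := hcard e he
    have h1 : (#{f ∈ avail E supp A | v ∉ supp f ∧ ¬Disjoint (supp e) (supp f)} : ℝ) ≤
        ∑ u ∈ (supp e).erase v, (deg E supp A u : ℝ) := by
      exact_mod_cast card_hitting_le v e
    refine h1.trans ?_
    rw [← hc, ← nsmul_eq_mul]
    exact sum_le_card_nsmul _ _ _ fun u hu => (hdeg u (heA (mem_of_mem_erase hu))).2
  have hS1 : deg E supp A v * (r - 1) * (G * (1 - 2 * e)) ≤ S := by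
    rw [hSeq, mul_assoc]
    nth_rewrite 1 [deg]
    rw [← nsmul_eq_mul]
    refine card_nsmul_le_sum _ _ _ fun e₁ he₁ => ?_
    obtain ⟨hc, heE, hve, heA⟩ := hcard e₁ he₁
    have h1 : ∑ u ∈ (supp e₁).erase v, (deg E supp A u : ℝ) ≤
        (#{f ∈ avail E supp A | v ∉ supp f ∧ ¬Disjoint (supp e₁) (supp f)} : ℝ) +
          (r - 1) * (r * κ) := by
      rw [← hcast]
      exact_mod_cast sum_deg_le_card_hitting hr hκ heE hve
    have h2 : (r - 1) * (G * (1 - e)) ≤ ∑ u ∈ (supp e₁).erase v, (deg E supp A u : ℝ) := by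
      rw [← hc, ← nsmul_eq_mul]
      exact card_nsmul_le_sum _ _ _ fun u hu => (hdeg u (heA (mem_of_mem_erase hu))).1
    have h3 : ((r : ℝ) - 1) * (r * κ) ≤ (r - 1) * (e * G) := by gcongr
    have h4 : ((r : ℝ) - 1) * (G * (1 - 2 * e)) =
        (r - 1) * (G * (1 - e)) - (r - 1) * (e * G) := by ring
    linarith
  have hmean := abs_sub_le_of_ratio_bounds (Nat.cast_nonneg _) hr1' hA' hG he0 he hS1 hS2 hm1 hm2
  rw [← hτ] at hmean
  have hv2 : (deg E supp A v : ℝ) ≤ 2 * G := by nlinarith [(hdeg v hv).2]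
  refine le_trans ?_ (sum_exp_le_card_mul (avail E supp A) (fun f => (hits E supp A v f : ℝ))
    (H := r * κ) hs (fun f _ => by positivity)
    (fun f hf => by exact_mod_cast hits_le hr hκ v (mem_avail.1 hf).1)
    (Nat.cast_nonneg _) hv2 hG hτ0 hτ2 he0 he hlam hsmall hmean he')
  rw [sum_filter]
  refine sum_le_sum fun f _ => ?_
  split_ifs with hvf
  · positivity
  · have h1 : (deg E supp (A \ supp f) v : ℝ) = deg E supp A v - hits E supp A v f := by
      rw [eq_sub_iff_add_eq]
      exact_mod_cast deg_sdiff_add_hits hvf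
    rw [h1]

theorem sum_exp_card_inter_le {r : ℕ} (hr : ∀ e ∈ E, #(supp e) = r)
    {e' σ : ℝ} (hlam : 0 < lam) (hG : 0 < G) (hp : 0 < p) (he0 : 0 < e)
    (he : e ≤ 1 / 3) (hA : 0 < #A) (hσ : σ = r / #A) (hσ2 : σ ≤ 1 / 2)
    (hdeg : ∀ v ∈ A, G * (1 - e) ≤ deg E supp A v ∧ deg E supp A v ≤ G * (1 + e))
    {B : Finset V} (hB : 0 < #B) (hBA : (#(B ∩ A) : ℝ) ≤ #B * p * (1 + e))
    (hsmall : lam * 1000 * (r / (#B * p) + σ) ≤ e) (he' : e + 14 * σ * e ≤ e') :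
    ∑ f ∈ avail E supp A,
      Real.exp (lam * (1 * (#(B ∩ (A \ supp f)) / (#B * (p * (1 - σ))) - 1) - e')) ≤
    #(avail E supp A) * Real.exp (lam * (1 * (#(B ∩ A) / (#B * p) - 1) - e)) := by
  have hA' : (0 : ℝ) < #A := by exact_mod_cast hA
  have hBp : (0 : ℝ) < #B * p := by positivity
  have hσ0 : 0 ≤ σ := by rw [hσ]; positivity
  obtain ⟨hm1, hm2⟩ := card_avail_bounds hr hdeg
  set S : ℝ := ∑ f ∈ avail E supp A, (#(supp f ∩ (B ∩ A)) : ℝ) with hS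
  have hSeq : S = ∑ u ∈ B ∩ A, (deg E supp A u : ℝ) := by
    rw [hS]
    exact_mod_cast (sum_deg (E := E) (supp := supp) (A := A) (B ∩ A)).symm
  have hS2 : S ≤ #(B ∩ A) * 1 * (G * (1 + e)) := by
    rw [hSeq, mul_one, ← nsmul_eq_mul]
    exact sum_le_card_nsmul _ _ _ fun u hu => (hdeg u (mem_inter.1 hu).2).2
  have hS1 : #(B ∩ A) * 1 * (G * (1 - 2 * e)) ≤ S := by
    rw [hSeq, mul_one, ← nsmul_eq_mul]
    refine card_nsmul_le_sum _ _ _ fun u hu => ?_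
    refine le_trans ?_ (hdeg u (mem_inter.1 hu).2).1
    gcongr
    linarith
  have hmean := abs_sub_le_of_ratio_bounds (Nat.cast_nonneg _) zero_le_one hA' hG he0 he
    hS1 hS2 hm1 hm2
  rw [one_mul, ← hσ] at hmean
  have hv2 : (#(B ∩ A) : ℝ) ≤ 2 * (#B * p) := by nlinarith
  refine le_trans ?_ (sum_exp_le_card_mul (avail E supp A)
    (fun f => (#(supp f ∩ (B ∩ A)) : ℝ)) (H := r) (Or.inl rfl) (fun f _ => by positivity)
    (fun f hf => ?_)
    (Nat.cast_nonneg _) hv2 hBp hσ0 hσ2 he0 he hlam hsmall hmean he')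
  · refine le_of_eq (sum_congr rfl fun f _ => ?_)
    have h1 : #(B ∩ (A \ supp f)) + #(supp f ∩ (B ∩ A)) = #(B ∩ A) := by
      rw [← card_sdiff_add_card_inter (B ∩ A) (supp f), inter_sdiff_assoc,
        inter_comm (supp f)]
    have h2 : (#(B ∩ (A \ supp f)) : ℝ) = #(B ∩ A) - #(supp f ∩ (B ∩ A)) := by
      rw [← h1]
      push_cast
      ring
    rw [h2, mul_assoc (#B : ℝ)]
  · rw [← hr f (mem_avail.1 hf).1]
    exact_mod_cast card_le_card inter_subset_left

theorem exists_potential_le {κ r : ℕ} (hr : ∀ e ∈ E, #(supp e) = r) (hr2 : 2 ≤ r)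
    (hκ : ∀ u v : V, u ≠ v → #{e ∈ E | u ∈ supp e ∧ v ∈ supp e} ≤ κ)
    {e' σ τ : ℝ} (hlam : 0 < lam) (hG : 0 < G) (hp : 0 < p) (he0 : 0 < e)
    (he : e ≤ 1 / 3) (hA : 0 < #A) (hσ : σ = r / #A) (hτ : τ = (r - 1) * r / #A)
    (hτ2 : τ ≤ 1 / 2) (hκe : r * κ ≤ e * G) (hsmall : lam * 1000 * (r * κ / G + τ) ≤ e)
    (hW : ∀ j ∈ J, 0 < #(W j)) (hsmallW : ∀ j ∈ J, lam * 1000 * (r / (#(W j) * p) + τ) ≤ e)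
    (he' : e + 14 * τ * e ≤ e') (hpot : potential E supp J W lam A G p e < 1) :
    ∃ f ∈ avail E supp A,
      potential E supp J W lam (A \ supp f) (G * (1 - τ)) (p * (1 - σ)) e' < 1 := by
  have hdeg := fun v hv => deg_bounds_of_potential_lt_one hlam hG hpot (v := v) hv
  have hA' : (0 : ℝ) < #A := by exact_mod_cast hA
  have hr2' : (2 : ℝ) ≤ r := by exact_mod_cast hr2
  have hσ0 : 0 ≤ σ := by rw [hσ]; positivity
  have hστ : σ ≤ τ := by
    rw [hσ, hτ]
    gcongr
    nlinarith
  have hne : 0 < #(avail E supp A) := by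
    have h1 := (card_avail_bounds hr hdeg).1
    have h2 : 0 < (#A : ℝ) * (G * (1 - e)) := by
      have : 0 < 1 - e := by linarith
      positivity
    rw [Nat.pos_iff_ne_zero]
    intro h0
    rw [h0, Nat.cast_zero, zero_mul] at h1
    linarith
  have key : ∑ f ∈ avail E supp A,
      potential E supp J W lam (A \ supp f) (G * (1 - τ)) (p * (1 - σ)) e' ≤
        #(avail E supp A) * potential E supp J W lam A G p e := by
    unfold potential
    rw [sum_add_distrib, mul_add]
    refine add_le_add ?_ ?_
    · have hswap : ∀ F : β → V → ℝ, ∑ f ∈ avail E supp A, ∑ v ∈ A \ supp f, F f v =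
          ∑ v ∈ A, ∑ f ∈ avail E supp A with v ∉ supp f, F f v := by
        intro F
        refine sum_comm' fun f v => ?_
        simp only [mem_sdiff, mem_filter]
        tauto
      rw [hswap, mul_sum]
      refine sum_le_sum fun v hv => ?_
      rw [sum_add_distrib, mul_add]
      exact add_le_add
        (sum_exp_deg_le hr (by omega) hκ (Or.inl rfl) hlam hG he0 he hA hτ hτ2 hdeg hκe hsmall
          he' hv)
        (sum_exp_deg_le hr (by omega) hκ (Or.inr rfl) hlam hG he0 he hA hτ hτ2 hdeg hκe hsmall
          he' hv)
    · rw [sum_comm, mul_sum]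
      refine sum_le_sum fun j hj => ?_
      refine sum_exp_card_inter_le hr hlam hG hp he0 he hA hσ (hστ.trans hτ2) hdeg (hW j hj)
        (card_inter_le_of_potential_lt_one hlam hp hpot hj (hW j hj)) ?_ ?_
      · refine le_trans ?_ (hsmallW j hj)
        gcongr
      · refine le_trans ?_ he'
        gcongr
  by_contra! hcon
  have h1 : (#(avail E supp A) : ℝ) ≤ ∑ f ∈ avail E supp A,
      potential E supp J W lam (A \ supp f) (G * (1 - τ)) (p * (1 - σ)) e' := by
    rw [← nsmul_one]
    exact card_nsmul_le_sum _ _ _ hcon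
  have hne' : (0 : ℝ) < #(avail E supp A) := by exact_mod_cast hne
  nlinarith

theorem one_sub_pow_le {σ : ℝ} {r : ℕ} (hσ0 : 0 ≤ σ) (hσ1 : σ ≤ 1)
    (h : r * ((r - 1) * σ) ≤ 1) : (1 - σ) ^ r ≤ 1 - (r - 1) * σ := by
  have h1 : 1 + r * σ ≤ (1 + σ) ^ r := one_add_mul_le_pow (by linarith) r
  have h2 : (1 - σ) ^ r * (1 + σ) ^ r ≤ 1 := by
    rw [← mul_pow]
    exact pow_le_one₀ (by nlinarith) (by nlinarith)
  have h3 : 0 ≤ (1 - σ) ^ r := pow_nonneg (by linarith) r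
  have hrσ : 0 ≤ (r : ℝ) * σ := by positivity
  have h4 : (1 - σ) ^ r * (1 + r * σ) ≤ 1 := (mul_le_mul_of_nonneg_left h1 h3).trans h2
  have h5 : 1 ≤ (1 - (r - 1) * σ) * (1 + r * σ) := by
    nlinarith [mul_nonneg hσ0 (sub_nonneg.2 h)]
  exact le_of_mul_le_mul_right (h4.trans h5) (by linarith)

theorem one_add_mul_mul_one_sub_pow_le {σ : ℝ} (hσ0 : 0 ≤ σ) (hσ1 : σ ≤ 1) (m : ℕ) :
    (1 + m * σ) * (1 - σ) ^ m ≤ 1 := by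
  have h1 : 1 + m * σ ≤ (1 + σ) ^ m := one_add_mul_le_pow (by linarith) m
  have h3 : 0 ≤ (1 - σ) ^ m := pow_nonneg (by linarith) m
  refine (mul_le_mul_of_nonneg_right h1 h3).trans ?_
  rw [← mul_pow]
  exact pow_le_one₀ (by nlinarith) (by nlinarith)

set_option maxHeartbeats 1000000 in
/-- Nearly perfect matching: in an `r`-uniform `D`-regular hypergraph with small
codegrees there is a matching that leaves uncovered at most a proportion `4 * η` of each of the
test sets `W j`. -/
theorem exists_matching {V₀ : Finset V} {r κ D : ℕ} (hr : ∀ e ∈ E, #(supp e) = r) (hr2 : 2 ≤ r)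
    (hκ : ∀ u v : V, u ≠ v → #{e ∈ E | u ∈ supp e ∧ v ∈ supp e} ≤ κ)
    (hV : ∀ e ∈ E, supp e ⊆ V₀) (hD : ∀ v ∈ V₀, #{e ∈ E | v ∈ supp e} = D) (hDpos : 0 < D)
    (hV₀ : 0 < #V₀) (hW : ∀ j ∈ J, 0 < #(W j)) (hWV : ∀ j ∈ J, W j ⊆ V₀)
    {δ η e₀ : ℝ} (hη0 : 0 < η) (hη1 : η ≤ 1) (he₀ : 0 < e₀) (hlam : 0 < lam)
    (hδκ : r * κ / D ≤ δ) (hδV : (r : ℝ) ^ 2 / #V₀ ≤ δ) (hδW : ∀ j ∈ J, (r : ℝ) / #(W j) ≤ δ)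
    (hsmall : lam * 2000 * (δ / η ^ r) ≤ e₀) (hδe : δ / η ^ r ≤ e₀) (hδr : r * (δ / η ^ r) ≤ 1)
    (he : e₀ / η ^ (14 * (r - 1)) ≤ 1 / 3)
    (hexp : (2 * #V₀ + #J) * Real.exp (-(lam * e₀)) < 1) :
    ∃ M ⊆ E, (M : Set β).PairwiseDisjoint supp ∧
      ∀ j ∈ J, (#(W j \ M.biUnion supp) : ℝ) ≤ 4 * η * #(W j) := by
  classical
  set N : ℝ := (#V₀ : ℝ) with hN
  have hN0 : 0 < N := by rw [hN]; exact_mod_cast hV₀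
  have hr2' : (2 : ℝ) ≤ r := by exact_mod_cast hr2
  have hD0 : (0 : ℝ) < D := by exact_mod_cast hDpos
  have hcast : ((r - 1 : ℕ) : ℝ) = r - 1 := by
    have : 1 ≤ r := by omega
    push_cast [this]
    ring
  have hδ0 : 0 < δ := lt_of_lt_of_le (by positivity) hδV
  have hηr : 0 < η ^ r := by positivity
  have hηr_le : η ^ r ≤ η := pow_le_of_le_one hη0.le hη1 (by omega)
  set b := δ / η ^ r with hb
  have hb0 : 0 < b := by positivity
  have hb2 : b ≤ 1 / 2 := by nlinarith
  have hδη : δ / η ≤ b := by rw [hb]; gcongr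
  have hrN : (r : ℝ) ≤ η * N := by
    have h1 : (r : ℝ) ^ 2 ≤ δ * N := by rwa [div_le_iff₀ hN0] at hδV
    have h2 : δ ≤ η := by
      have : δ ≤ b * η := by rwa [div_le_iff₀ hη0] at hδη
      nlinarith
    nlinarith
  have main : ∀ i : ℕ, η * N ≤ N - i * r → ∃ M ⊆ E, (M : Set β).PairwiseDisjoint supp ∧
      (#(V₀ \ M.biUnion supp) : ℝ) = N - i * r ∧
      ∃ q : ℝ, ((N - i * r) / N) ^ r ≤ q ∧
        potential E supp J W lam (V₀ \ M.biUnion supp) (D * q) ((N - i * r) / N)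
          (e₀ / ((N - i * r) / N) ^ (14 * (r - 1))) < 1 := by
    intro i
    induction i with
    | zero =>
      intro _
      refine ⟨∅, empty_subset _, by simp, by simp [hN], 1, by simp [hN0.ne'], ?_⟩
      have hdeg : ∀ v ∈ V₀, (deg E supp V₀ v : ℝ) = D := by
        intro v hv
        rw [deg, avail, filter_true_of_mem hV, hD v hv]
      simp only [biUnion_empty, sdiff_empty, Nat.cast_zero, zero_mul, sub_zero, div_self hN0.ne',
        one_pow, mul_one, div_one, potential]
      rw [sum_congr rfl fun v hv => by rw [hdeg v hv, div_self hD0.ne'],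
        sum_congr (s₁ := J) rfl fun j hj => by
          rw [inter_eq_left.2 (hWV j hj), div_self (by exact_mod_cast (hW j hj).ne')]]
      simp only [sub_self, mul_zero, zero_sub, mul_neg, sum_const, nsmul_eq_mul]
      linarith
    | succ i ih =>
      intro hi
      push_cast at hi
      obtain ⟨M, hME, hM, hA, q, hq, hpot⟩ := ih (by linarith)
      set A := V₀ \ M.biUnion supp with hAdef
      set P : ℝ := N - i * r with hP
      have hPη : η * N + r ≤ P := by linarith
      have hηN : 0 < η * N := by positivity
      have hP0 : 0 < P := by linarith
      set p := P / N with hp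
      have hp0 : 0 < p := by positivity
      have hpη : η ≤ p := by rw [hp, le_div_iff₀ hN0]; linarith
      have hp1 : p ≤ 1 := by
        rw [hp, div_le_one hN0]
        have : 0 ≤ (i : ℝ) * r := by positivity
        linarith
      set m := 14 * (r - 1) with hm
      have hm' : (m : ℝ) = 14 * (r - 1) := by rw [hm]; push_cast [hcast]; ring
      set e := e₀ / p ^ m with he_def
      set σ := r / P with hσ
      set τ := (r - 1) * r / P with hτ
      have hτσ : τ = (r - 1) * σ := by rw [hτ, hσ]; ring
      have hσ0 : 0 ≤ σ := by positivity
      have hτb : τ ≤ b := by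
        refine le_trans ?_ hδη
        rw [hτ, div_le_div_iff₀ hP0 hη0]
        have h1 : (r : ℝ) ^ 2 ≤ δ * N := by rwa [div_le_iff₀ hN0] at hδV
        calc ((r : ℝ) - 1) * r * η ≤ r ^ 2 * η := by gcongr; linarith
          _ ≤ δ * N * η := by gcongr
          _ = δ * (η * N) := by ring
          _ ≤ δ * P := by gcongr; linarith
      have hστ : σ ≤ τ := by rw [hτσ]; nlinarith
      have hσ1 : σ ≤ 1 / 2 := by linarith
      have hτ0 : 0 ≤ τ := hσ0.trans hστ
      have hηq : η ^ r ≤ q := le_trans (by gcongr) hq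
      have hq0 : 0 < q := by linarith
      have he0 : 0 < e := by positivity
      have hee₀ : e₀ ≤ e := by
        rw [he_def, le_div_iff₀ (by positivity)]
        exact mul_le_of_le_one_right he₀.le (pow_le_one₀ hp0.le hp1)
      have he3 : e ≤ 1 / 3 := le_trans (by rw [he_def]; gcongr) he
      have hpσ : p * (1 - σ) = (N - (i + 1 : ℕ) * r) / N := by
        rw [hp, hσ, hP]
        have : N - i * r ≠ 0 := hP0.ne'
        field_simp
        push_cast
        ring
      have hκb : r * κ / (D * q) ≤ b := by
        rw [← div_div, hb]
        gcongr
      have hcardA : 0 < #A := by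
        have : (0 : ℝ) < #A := by rw [hA]; exact hP0
        exact_mod_cast this
      have he' : e + 14 * τ * e ≤ e₀ / (p * (1 - σ)) ^ m := by
        have h1 : (1 + m * σ) * (1 - σ) ^ m ≤ 1 :=
          one_add_mul_mul_one_sub_pow_le hσ0 (by linarith) m
        have h2 : 14 * τ = m * σ := by rw [hτσ, hm']; ring
        have h3 : 0 < (1 - σ) ^ m := pow_pos (by linarith) m
        rw [mul_pow, ← div_div, le_div_iff₀ h3, h2]
        calc (e + m * σ * e) * (1 - σ) ^ m = e * ((1 + m * σ) * (1 - σ) ^ m) := by ring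
          _ ≤ e := mul_le_of_le_one_right he0.le h1
      have hsmall' : ∀ y : ℝ, y ≤ b → lam * 1000 * (y + τ) ≤ e := by
        intro y hy
        calc lam * 1000 * (y + τ) ≤ lam * 1000 * (b + b) := by gcongr
          _ = lam * 2000 * b := by ring
          _ ≤ e := hsmall.trans hee₀
      obtain ⟨f, hf, hfpot⟩ := exists_potential_le (σ := σ) (τ := τ)
        (e' := e₀ / (p * (1 - σ)) ^ m) hr hr2 hκ hlam (mul_pos hD0 hq0)
        hp0 he0 he3 hcardA (by rw [hA]) (by rw [hA]) (hτb.trans hb2)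
        (by
          rw [div_le_iff₀ (by positivity)] at hκb
          refine hκb.trans ?_
          gcongr
          exact hδe.trans hee₀)
        (hsmall' _ hκb) hW
        (fun j hj => hsmall' _ (by
          rw [← div_div]
          refine le_trans ?_ hδη
          gcongr
          exact hδW j hj))
        he' hpot
      obtain ⟨hfE, hfA⟩ := mem_avail.1 hf
      have hunion : V₀ \ (insert f M).biUnion supp = A \ supp f := by
        rw [biUnion_insert, union_comm, hAdef, sdiff_sdiff_left]
        rfl
      refine ⟨insert f M, insert_subset hfE hME, ?_, ?_, q * (1 - τ), ?_, ?_⟩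
      · rw [coe_insert]
        refine hM.insert fun g hg _ => ?_
        refine disjoint_left.2 fun v hvf hvg => ?_
        exact (mem_sdiff.1 (hfA hvf)).2 (mem_biUnion.2 ⟨g, hg, hvg⟩)
      · rw [hunion, cast_card_sdiff hfA, hr f hfE, hA]
        push_cast
        ring
      · rw [← hpσ, mul_pow, hτσ]
        refine mul_le_mul hq (one_sub_pow_le hσ0 (by linarith) ?_)
          (pow_nonneg (by linarith) r) hq0.le
        rw [← hτσ]
        exact le_trans (by gcongr) hδr
      · rw [hunion, ← hpσ, ← mul_assoc]
        exact hfpot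
  set i := ⌊(1 - η) * N / r⌋₊ with hi
  have hr0 : (0 : ℝ) < r := by linarith
  have hi1 : i * r ≤ (1 - η) * N := by
    rw [← le_div_iff₀ hr0]
    exact Nat.floor_le (by
      have : 0 ≤ 1 - η := by linarith
      positivity)
  have hi2 : (1 - η) * N < (i + 1) * r := by
    rw [← div_lt_iff₀ hr0]
    exact Nat.lt_floor_add_one _
  obtain ⟨M, hME, hM, hA, q, hq, hpot⟩ := main i (by linarith)
  refine ⟨M, hME, hM, fun j hj => ?_⟩
  set p := (N - i * r) / N with hp
  have hpη : η ≤ p := by rw [hp, le_div_iff₀ hN0]; linarith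
  have hp0 : 0 < p := by linarith
  have hp2 : p ≤ 2 * η := by rw [hp, div_le_iff₀ hN0]; linarith
  have h1 := card_inter_le_of_potential_lt_one hlam hp0 hpot hj (hW j hj)
  have h2 : W j ∩ (V₀ \ M.biUnion supp) = W j \ M.biUnion supp := by
    rw [← inter_sdiff_assoc, inter_eq_left.2 (hWV j hj)]
  rw [h2] at h1
  have he3 : e₀ / p ^ (14 * (r - 1)) ≤ 1 / 3 := le_trans (by gcongr) he
  refine h1.trans ?_
  have he0 : 0 < e₀ / p ^ (14 * (r - 1)) := by positivity
  calc (#(W j) : ℝ) * p * (1 + e₀ / p ^ (14 * (r - 1))) ≤ #(W j) * (2 * η) * (1 + 1) := by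
        gcongr
        linarith
    _ = _ := by ring

end Matching

theorem card_powersetCard_filter_superset {α : Type*} [Fintype α] [DecidableEq α] {k : ℕ}
    {T : Finset α} (hT : #T ≤ k) :
    #{K ∈ powersetCard k (univ : Finset α) | T ⊆ K} =
      (Fintype.card α - #T).choose (k - #T) := by
  rw [← card_compl, ← card_powersetCard]
  refine card_nbij' (fun K => K \ T) (fun K => K ∪ T) ?_ ?_ ?_ ?_
  · intro K hK
    simp only [coe_filter, mem_powersetCard, Set.mem_ofPred_eq, mem_coe] at hK ⊢
    refine ⟨fun x hx => ?_, ?_⟩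
    · exact mem_compl.2 (mem_sdiff.1 hx).2
    · rw [card_sdiff_of_subset hK.2, hK.1.2]
  · intro K hK
    simp only [coe_filter, mem_powersetCard, Set.mem_ofPred_eq, mem_coe] at hK ⊢
    have hd : Disjoint K T := disjoint_left.2 fun x hx => mem_compl.1 (hK.1 hx)
    refine ⟨⟨subset_univ _, ?_⟩, subset_union_right⟩
    rw [card_union_of_disjoint hd, hK.2]
    omega
  · intro K hK
    simp only [coe_filter, mem_powersetCard, Set.mem_ofPred_eq] at hK
    exact sdiff_union_of_subset hK.2
  · intro K hK
    simp only [mem_powersetCard, mem_coe] at hK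
    have hd : Disjoint K T := disjoint_left.2 fun x hx => mem_compl.1 (hK.1 hx)
    exact union_sdiff_cancel_right hd

theorem succ_le_choose_add {a : ℕ} (b : ℕ) (ha : 1 ≤ a) : b + 1 ≤ (b + a).choose a := by
  induction a, ha using Nat.le_induction with
  | base => simp
  | succ a _ ih =>
    rw [← add_assoc, Nat.choose_succ_succ]
    omega

theorem half_le_choose {n t ℓ : ℕ} (hn : 2 * t ≤ n) (hℓ : ℓ < t) :
    (n : ℝ) / 2 ≤ (n - ℓ).choose (t - ℓ) := by
  have h1 := succ_le_choose_add (n - t) (a := t - ℓ) (by omega)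
  rw [show n - t + (t - ℓ) = n - ℓ by omega] at h1
  rw [div_le_iff₀ (by norm_num)]
  have h2 : n ≤ (n - ℓ).choose (t - ℓ) * 2 := by omega
  exact_mod_cast h2

theorem card_filter_card_lt_le {n t : ℕ} (hn : 1 ≤ n) :
    #{X : Finset (Fin n) | #X < t} ≤ t * n ^ t := by
  have hsub : ({X : Finset (Fin n) | #X < t} : Finset (Finset (Fin n))) ⊆
      (range t).biUnion fun ℓ => powersetCard ℓ univ := by
    intro X hX
    simpa [mem_powersetCard] using hX
  refine (card_le_card hsub).trans ?_
  refine (card_biUnion_le_card_mul _ _ (n ^ t) fun ℓ hℓ => ?_).trans (by simp)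
  rw [card_powersetCard, card_univ, Fintype.card_fin]
  exact (Nat.choose_le_pow n ℓ).trans (Nat.pow_le_pow_right hn (mem_range.1 hℓ).le)

theorem two_le_choose {k t : ℕ} (htk : t < k) (ht : 1 ≤ t) : 2 ≤ k.choose t := by
  obtain ⟨k, rfl⟩ : ∃ j, k = j + 1 := ⟨k - 1, by omega⟩
  obtain ⟨t, rfl⟩ : ∃ j, t = j + 1 := ⟨t - 1, by omega⟩
  rw [Nat.choose_succ_succ']
  have h1 := Nat.choose_pos (show t ≤ k by omega)
  have h2 := Nat.choose_pos (show t + 1 ≤ k by omega)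
  omega

theorem card_filter_pair_le {α : Type*} [Fintype α] [DecidableEq α] {k t : ℕ}
    {u v : Finset α} (huv : u ≠ v) :
    #{K ∈ powersetCard k (univ : Finset α) | u ∈ powersetCard t K ∧ v ∈ powersetCard t K} ≤
      (Fintype.card α - t - 1).choose (k - t - 1) := by
  rcases eq_empty_or_nonempty
    {K ∈ powersetCard k (univ : Finset α) | u ∈ powersetCard t K ∧ v ∈ powersetCard t K}
    with h | ⟨K, hK⟩
  · rw [h, card_empty]
    exact Nat.zero_le _
  simp only [mem_filter, mem_powersetCard] at hK
  obtain ⟨⟨-, hKk⟩, ⟨huK, hu⟩, hvK, hv⟩ := hK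
  have hnot : ¬v ⊆ u := fun h => huv (eq_of_subset_of_card_le h (by omega)).symm
  obtain ⟨x, hxv, hxu⟩ := not_subset.1 hnot
  have hcard : #(insert x u) = t + 1 := by rw [card_insert_of_notMem hxu, hu]
  have hle : #(insert x u) ≤ k := by
    rw [← hKk]
    exact card_le_card (insert_subset (hvK hxv) huK)
  have h1 := card_powersetCard_filter_superset hle
  rw [hcard] at h1
  rw [Nat.sub_sub, Nat.sub_sub, ← h1]
  refine card_le_card fun K' hK' => ?_
  simp only [mem_filter, mem_powersetCard] at hK' ⊢
  exact ⟨hK'.1, insert_subset (hK'.2.2.1 hxv) hK'.2.1.1⟩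

theorem mul_choose_div_choose_le {n k t : ℕ} (htk : t < k) (hkn : k ≤ n) (hn : 2 * t ≤ n) :
    (n : ℝ) * (n - t - 1).choose (k - t - 1) ≤ 2 * k * (n - t).choose (k - t) := by
  have h1 := Nat.add_one_mul_choose_eq (n - t - 1) (k - t - 1)
  rw [show n - t - 1 + 1 = n - t by omega, show k - t - 1 + 1 = k - t by omega] at h1
  have h2 : n * (n - t - 1).choose (k - t - 1) ≤ 2 * k * (n - t).choose (k - t) := by
    calc n * (n - t - 1).choose (k - t - 1)
        ≤ (2 * (n - t)) * (n - t - 1).choose (k - t - 1) := by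
          gcongr
          omega
      _ = 2 * ((n - t).choose (k - t) * (k - t)) := by rw [mul_assoc, h1]
      _ ≤ 2 * ((n - t).choose (k - t) * k) := by
          gcongr
          omega
      _ = _ := by ring
  exact_mod_cast h2

/-- The conclusion for a given `n = x ^ 8` with `x` large, with proportion `4 * η` uncovered. -/
theorem exists_partial_steiner {k t n : ℕ} (htk : t < k) (ht : 1 ≤ t) (hkn : k ≤ n)
    (hn : 2 * t ≤ n) {x η : ℝ} (hx : x ^ 8 = n) (hx3 : 3 ≤ x)
    (hxc : 2000 * (2 * (k.choose t : ℝ) ^ 3 * k) ≤ x) (hη0 : 0 < η) (hη1 : η ≤ 1)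
    (hη : η ^ (14 * (k.choose t - 1)) = x⁻¹)
    (hexp : (2 + t) * (x ^ (8 * t) * Real.exp (-x)) < 1) :
    ∃ 𝓕 : Finset (Finset (Fin n)), (∀ F ∈ 𝓕, #F = k) ∧
      (∀ A : Finset (Fin n), #A = t → #{F ∈ 𝓕 | A ⊆ F} ≤ 1) ∧
      ∀ ℓ : ℕ, ℓ < t → ∀ X' : Finset (Fin n), #X' = ℓ →
        (#{A ∈ powersetCard t (univ : Finset (Fin n)) | X' ⊆ A ∧ ∀ F ∈ 𝓕, ¬A ⊆ F} : ℝ) ≤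
          4 * η * (n : ℝ) ^ (t - ℓ) := by
  set r := k.choose t with hr
  have hr2 : 2 ≤ r := two_le_choose htk ht
  have hr2' : (2 : ℝ) ≤ r := by exact_mod_cast hr2
  have hk1 : (1 : ℝ) ≤ k := by exact_mod_cast (by omega : 1 ≤ k)
  have hn1 : 1 ≤ n := by omega
  have hn0 : (0 : ℝ) < n := by exact_mod_cast hn1
  have hx0 : 0 < x := by linarith
  set c : ℝ := 2 * (r : ℝ) ^ 2 * k with hc
  have hc0 : 0 < c := by positivity
  have hrc : 2000 * (r * c) ≤ x := by rw [hc]; linarith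
  have hcx : 2000 * c ≤ x := by nlinarith
  set W : Finset (Fin n) → Finset (Finset (Fin n)) := fun X =>
    {A ∈ powersetCard t (univ : Finset (Fin n)) | X ⊆ A} with hWdef
  have hWcard : ∀ X, #X < t → #(W X) = (n - #X).choose (t - #X) := by
    intro X hX
    rw [hWdef, card_powersetCard_filter_superset hX.le, Fintype.card_fin]
  have hWhalf : ∀ X, #X < t → (n : ℝ) / 2 ≤ #(W X) := by
    intro X hX
    rw [hWcard X hX]
    exact half_le_choose hn hX
  have hV₀card : #(powersetCard t (univ : Finset (Fin n))) = n.choose t := by simp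
  have hV₀half : (n : ℝ) / 2 ≤ #(powersetCard t (univ : Finset (Fin n))) := by
    rw [hV₀card]
    exact half_le_choose (ℓ := 0) hn (by omega)
  have hδη : c / n / η ^ r ≤ c / x ^ 7 := by
    have h1 : x⁻¹ ≤ η ^ r := by
      rw [← hη]
      exact pow_le_pow_of_le_one hη0.le hη1 (by omega)
    calc c / n / η ^ r ≤ c / n / x⁻¹ := by gcongr
      _ = c / x ^ 7 := by
        rw [← hx]
        field_simp
  have hx7 : c / x ^ 7 ≤ 1 / x ^ 2 := by
    rw [div_le_div_iff₀ (by positivity) (by positivity)]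
    have h1 : x * 1 ≤ x * x ^ 4 := by
      gcongr
      exact one_le_pow₀ (by linarith)
    calc c * x ^ 2 ≤ (x * x ^ 4) * x ^ 2 := by gcongr; linarith
      _ = 1 * x ^ 7 := by ring
  obtain ⟨M, hME, hM, hMW⟩ := exists_matching
    (E := powersetCard k (univ : Finset (Fin n))) (supp := fun K => powersetCard t K)
    (J := ({X | #X < t} : Finset (Finset (Fin n)))) (W := W)
    (V₀ := powersetCard t (univ : Finset (Fin n))) (r := r)
    (κ := (n - t - 1).choose (k - t - 1)) (D := (n - t).choose (k - t))
    (δ := c / n) (η := η) (e₀ := 1 / x ^ 2) (lam := x ^ 4)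
    (fun K hK => by rw [card_powersetCard, (mem_powersetCard.1 hK).2])
    hr2
    (fun u v huv => by simpa using card_filter_pair_le (k := k) (t := t) huv)
    (fun K _ => powersetCard_mono (subset_univ K))
    (fun v hv => by
      have hv' := (mem_powersetCard.1 hv).2
      have h1 := card_powersetCard_filter_superset (k := k) (T := v) (by omega)
      rw [hv', Fintype.card_fin] at h1
      rw [← h1]
      congr 1
      ext K
      simp [mem_powersetCard, hv'])
    (Nat.choose_pos (by omega))
    (by rw [hV₀card]; exact Nat.choose_pos (by omega))
    (fun X hX => by
      simp only [mem_filter, mem_univ, true_and] at hX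
      rw [hWcard X hX]
      exact Nat.choose_pos (by omega))
    (fun X _ => filter_subset _ _)
    hη0 hη1 (by positivity) (by positivity)
    (by
      have hD : (0 : ℝ) < (n - t).choose (k - t) := by
        exact_mod_cast Nat.choose_pos (by omega)
      rw [div_le_div_iff₀ hD hn0]
      have h1 := mul_choose_div_choose_le htk hkn hn
      calc (r : ℝ) * (n - t - 1).choose (k - t - 1) * n
          = r * (n * (n - t - 1).choose (k - t - 1)) := by ring
        _ ≤ r * (2 * k * (n - t).choose (k - t)) := by gcongr
        _ = 2 * (1 * r) * k * (n - t).choose (k - t) := by ring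
        _ ≤ 2 * (r * r) * k * (n - t).choose (k - t) := by gcongr; linarith
        _ = c * (n - t).choose (k - t) := by rw [hc]; ring)
    (by
      rw [div_le_div_iff₀ (by linarith) hn0, hc]
      calc (r : ℝ) ^ 2 * (n : ℝ) = 2 * r ^ 2 * 1 * (n / 2) := by ring
        _ ≤ 2 * r ^ 2 * k * (#(powersetCard t (univ : Finset (Fin n))) : ℝ) := by gcongr)
    (fun X hX => by
      simp only [mem_filter, mem_univ, true_and] at hX
      have h1 := hWhalf X hX
      rw [div_le_div_iff₀ (by linarith) hn0, hc]
      calc (r : ℝ) * (n : ℝ) = 2 * (r * 1) * 1 * (n / 2) := by ring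
        _ ≤ 2 * (r * r) * k * (#(W X) : ℝ) := by gcongr; linarith
        _ = _ := by ring)
    (by
      calc x ^ 4 * 2000 * (c / n / η ^ r) ≤ x ^ 4 * 2000 * (c / x ^ 7) := by gcongr
        _ = 2000 * c / x ^ 3 := by field_simp
        _ ≤ x / x ^ 3 := by gcongr
        _ = 1 / x ^ 2 := by field_simp)
    (hδη.trans hx7)
    (by
      calc r * (c / n / η ^ r) ≤ r * (c / x ^ 7) := by gcongr
        _ = r * c / x ^ 7 := by ring
        _ ≤ x / x ^ 7 := by gcongr; nlinarith [mul_pos (by linarith : (0 : ℝ) < r) hc0]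
        _ ≤ 1 := by
          rw [div_le_one (by positivity)]
          exact le_self_pow₀ (by linarith) (by norm_num))
    (by
      rw [hη]
      calc 1 / x ^ 2 / x⁻¹ = 1 / x := by field_simp
        _ ≤ 1 / 3 := by gcongr)
    (by
      have h1 : -(x ^ 4 * (1 / x ^ 2)) ≤ -x := by
        have : x ^ 4 * (1 / x ^ 2) = x ^ 2 := by field_simp
        rw [this]
        nlinarith
      have h2 : (#(powersetCard t (univ : Finset (Fin n))) : ℝ) ≤ (n : ℝ) ^ t := by
        rw [hV₀card]
        exact_mod_cast Nat.choose_le_pow n t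
      have h3 : (#({X | #X < t} : Finset (Finset (Fin n))) : ℝ) ≤ t * (n : ℝ) ^ t := by
        exact_mod_cast card_filter_card_lt_le hn1
      refine lt_of_le_of_lt ?_ hexp
      rw [pow_mul, hx, ← mul_assoc]
      gcongr
      linarith)
  refine ⟨M, fun F hF => (mem_powersetCard.1 (hME hF)).2, fun A hA => ?_, fun ℓ hℓ X hX => ?_⟩
  · rw [card_le_one]
    intro F hF F' hF'
    simp only [mem_filter] at hF hF'
    by_contra hne
    exact disjoint_left.1 (hM hF.1 hF'.1 hne) (mem_powersetCard.2 ⟨hF.2, hA⟩)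
      (mem_powersetCard.2 ⟨hF'.2, hA⟩)
  · have hXt : #X < t := by omega
    have h1 := hMW X (by simpa using hXt)
    have h2 : ({A ∈ powersetCard t (univ : Finset (Fin n)) | X ⊆ A ∧ ∀ F ∈ M, ¬A ⊆ F} :
        Finset (Finset (Fin n))) ⊆ W X \ M.biUnion fun K => powersetCard t K := by
      intro A hA
      simp only [mem_filter] at hA
      simp only [hWdef, mem_sdiff, mem_filter, mem_biUnion, not_exists, not_and]
      exact ⟨⟨hA.1, hA.2.1⟩, fun F hF hAF => hA.2.2 F hF (mem_powersetCard.1 hAF).1⟩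
    have h3 : (#(W X) : ℝ) ≤ (n : ℝ) ^ (t - ℓ) := by
      rw [hWcard X hXt, hX]
      have := (Nat.choose_le_pow (n - ℓ) (t - ℓ)).trans
        (Nat.pow_le_pow_left (Nat.sub_le n ℓ) (t - ℓ))
      exact_mod_cast this
    calc _ ≤ (#(W X \ M.biUnion fun K => powersetCard t K) : ℝ) := by
          exact_mod_cast card_le_card h2
      _ ≤ 4 * η * #(W X) := h1
      _ ≤ _ := by gcongr

/-- For all integers `k > t ≥ 2` there exist `ε > 0`, `C > 0` and `n₀` such that for every
`n ≥ n₀` there is a partial Steiner system with parameters `t, k, n` whose leave hypergraph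
satisfies property (♣): every `ℓ`-element subset (`0 ≤ ℓ < t`) is contained in at most
`C · n^(t-ℓ-ε)` uncovered `t`-sets. -/
theorem partial_steiner_with_club :
    ∀ k t : ℕ, t < k → 2 ≤ t →
      ∃ ε C : ℝ, 0 < ε ∧ 0 < C ∧
        ∃ n₀ : ℕ, ∀ n : ℕ, n₀ ≤ n →
          ∃ 𝓕 : Finset (Finset (Fin n)),
            (∀ F ∈ 𝓕, F.card = k) ∧
            (∀ A : Finset (Fin n), A.card = t → (𝓕.filter fun F => A ⊆ F).card ≤ 1) ∧
            ∀ ℓ : ℕ, ℓ < t → ∀ X' : Finset (Fin n), X'.card = ℓ →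
              ((((Finset.powersetCard t (Finset.univ : Finset (Fin n))).filter
                  fun A => X' ⊆ A ∧ ∀ F ∈ 𝓕, ¬ A ⊆ F).card : ℝ))
                ≤ C * (n : ℝ) ^ ((t : ℝ) - (ℓ : ℝ) - ε) := by
  intro k t htk ht
  have hr2 : 2 ≤ k.choose t := two_le_choose htk (by omega)
  set m := 14 * (k.choose t - 1) with hm
  have hm0 : (0 : ℝ) < m := by
    have : 0 < m := by omega
    exact_mod_cast this
  have hx_top : Filter.Tendsto (fun n : ℕ => (n : ℝ) ^ (1 / 8 : ℝ)) Filter.atTop Filter.atTop :=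
    (tendsto_rpow_atTop (by norm_num)).comp tendsto_natCast_atTop_atTop
  have hexp : ∀ᶠ x : ℝ in Filter.atTop, (2 + t) * (x ^ (8 * t) * Real.exp (-x)) < 1 := by
    have h1 := (Real.tendsto_pow_mul_exp_neg_atTop_nhds_zero (8 * t)).const_mul ((2 : ℝ) + t)
    rw [mul_zero] at h1
    exact h1.eventually_lt_const one_pos
  obtain ⟨n₀, hn₀⟩ := Filter.eventually_atTop.1 ((hx_top.eventually_ge_atTop 3).and
    ((hx_top.eventually_ge_atTop (2000 * (2 * (k.choose t : ℝ) ^ 3 * k))).and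
      ((hx_top.eventually hexp).and (Filter.eventually_ge_atTop (k + 2 * t)))))
  refine ⟨1 / (8 * m), 4, by positivity, by norm_num, n₀, fun n hn => ?_⟩
  obtain ⟨hx3, hxc, hxe, hkn⟩ := hn₀ n hn
  have hn1 : (1 : ℝ) ≤ n := by exact_mod_cast (by omega : 1 ≤ n)
  have hn0 : (0 : ℝ) < n := by linarith
  have hx : ((n : ℝ) ^ (1 / 8 : ℝ)) ^ 8 = n := by
    rw [← Real.rpow_natCast, ← Real.rpow_mul hn0.le]
    norm_num
  have hη : ((n : ℝ) ^ (-(1 / (8 * m) : ℝ))) ^ m = ((n : ℝ) ^ (1 / 8 : ℝ))⁻¹ := by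
    rw [← Real.rpow_natCast, ← Real.rpow_mul hn0.le, ← Real.rpow_neg hn0.le]
    congr 1
    field_simp
  obtain ⟨𝓕, h1, h2, h3⟩ := exists_partial_steiner htk (by omega) (by omega) (by omega) hx hx3 hxc
    (Real.rpow_pos_of_pos hn0 _)
    (Real.rpow_le_one_of_one_le_of_nonpos hn1 (neg_nonpos.2 (by positivity))) hη hxe
  refine ⟨𝓕, h1, h2, fun ℓ hℓ X' hX' => (h3 ℓ hℓ X' hX').trans (le_of_eq ?_)⟩
  rw [mul_assoc, ← Real.rpow_natCast, ← Real.rpow_add hn0, Nat.cast_sub hℓ.le]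
  congr 2
  ring
end

section
/- Let k > t ≥ 2 be integers, ε ∈ (0,1) and C > 0 reals, and let 𝓕 be a family of k-element subsets of an n-element set X in which every t-element subset is contained in at most one member of 𝓕, whose leave hypergraph 𝓛 satisfies property (♣) with constants C, ε. Then for every A ∈ 𝓛, the number of k-element subsets of X that contain A and contain no other member of 𝓛 is at least C(n−t, k−t) − 2^t · C · n^{k−t−ε}, where C(a,b) denotes the binomial coefficient. -/
open Finset

/-- The number of `k`-element subsets of `X` containing `D`, bounded by a real power of `|X|`. -/
theorem card_filter_superset_powersetCard_le_rpow {α : Type*} [DecidableEq α] {X D : Finset α}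
    (hD : D ⊆ X) (k : ℕ) :
    (((powersetCard k X).filter fun S => D ⊆ S).card : ℝ)
      ≤ (X.card : ℝ) ^ ((k : ℝ) - (D.card : ℝ)) := by
  rcases le_or_gt D.card k with hk | hk
  · rw [card_filter_powersetCard_subset _ _ _ hD hk, ← Nat.cast_sub hk, Real.rpow_natCast]
    exact_mod_cast (Nat.choose_le_pow _ _).trans (Nat.pow_le_pow_left (Nat.sub_le _ _) _)
  · rw [filter_eq_empty_iff.2]
    · simpa using Real.rpow_nonneg (Nat.cast_nonneg _) _
    · intro S hS hDS
      have := card_le_card hDS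
      rw [(mem_powersetCard.1 hS).2] at this
      omega

/-- Given a partial Steiner system whose leave hypergraph `𝓛` satisfies property (♣) with
constants `C, ε`, for every `A ∈ 𝓛` the number of `k`-element subsets of `X` containing `A`
and containing no other member of `𝓛` is at least `C(n-t, k-t) - 2^t · C · n^(k-t-ε)`. -/
theorem many_potential_candidates {α : Type*} [DecidableEq α]
    (n k t : ℕ) (ε C : ℝ) (htk : t < k) (ht : 2 ≤ t)
    (hε0 : 0 < ε) (hε1 : ε < 1) (hC : 0 < C)
    (X : Finset α) (hX : X.card = n)
    (𝓕 : Finset (Finset α)) (h𝓕X : ∀ F ∈ 𝓕, F ⊆ X) (h𝓕k : ∀ F ∈ 𝓕, F.card = k)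
    (hpartial : ∀ A : Finset α, A ⊆ X → A.card = t →
      (𝓕.filter fun F => A ⊆ F).card ≤ 1)
    (𝓛 : Finset (Finset α))
    (h𝓛 : 𝓛 = (Finset.powersetCard t X).filter fun A => ∀ F ∈ 𝓕, ¬ A ⊆ F)
    (hclub : ∀ ℓ : ℕ, ℓ < t → ∀ X' : Finset α, X' ⊆ X → X'.card = ℓ →
      ((𝓛.filter fun A => X' ⊆ A).card : ℝ) ≤ C * (n : ℝ) ^ ((t : ℝ) - (ℓ : ℝ) - ε))
    (A : Finset α) (hA : A ∈ 𝓛) :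
    ((n - t).choose (k - t) : ℝ) - 2 ^ t * C * (n : ℝ) ^ ((k : ℝ) - (t : ℝ) - ε)
      ≤ (((Finset.powersetCard k X).filter
          fun S => A ⊆ S ∧ ∀ B ∈ 𝓛, B ≠ A → ¬ B ⊆ S).card : ℝ) := by
  have hA' := hA
  rw [h𝓛, mem_filter, mem_powersetCard] at hA'
  obtain ⟨⟨hAX, hAt⟩, -⟩ := hA'
  have hn : (0 : ℝ) < n := by
    have := card_le_card hAX
    exact_mod_cast (by omega : 0 < n)
  have hmem : ∀ B ∈ 𝓛, B ⊆ X ∧ B.card = t := fun B hB => by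
    rw [h𝓛, mem_filter, mem_powersetCard] at hB
    exact hB.1
  let sup (D : Finset α) : Finset (Finset α) := (powersetCard k X).filter fun S => D ⊆ S
  let bad (Y : Finset α) : Finset (Finset α) :=
    (𝓛.filter fun B => A ∩ B = Y).biUnion fun B => sup (A ∪ B)
  have hbad : ∀ Y ∈ A.ssubsets,
      ((bad Y).card : ℝ) ≤ C * (n : ℝ) ^ ((k : ℝ) - (t : ℝ) - ε) := by
    intro Y hY
    rw [mem_ssubsets] at hY
    have hYt : Y.card < t := hAt ▸ card_lt_card hY
    have hsup : ∀ B ∈ 𝓛.filter (fun B => A ∩ B = Y),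
        ((sup (A ∪ B)).card : ℝ) ≤ (n : ℝ) ^ ((k : ℝ) - 2 * t + Y.card) := by
      intro B hB
      obtain ⟨hBL, rfl⟩ := mem_filter.1 hB
      obtain ⟨hBX, hBt⟩ := hmem B hBL
      have h := card_filter_superset_powersetCard_le_rpow (union_subset hAX hBX) k
      have hc : ((A ∪ B).card : ℝ) + (A ∩ B).card = t + t := by
        have := card_union_add_card_inter A B
        rw [hAt, hBt] at this
        exact_mod_cast this
      rw [hX] at h
      convert h using 2
      linarith
    have hcount : ((𝓛.filter fun B => A ∩ B = Y).card : ℝ)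
        ≤ C * (n : ℝ) ^ ((t : ℝ) - (Y.card : ℝ) - ε) := by
      refine le_trans ?_ (hclub Y.card hYt Y (hY.subset.trans hAX) rfl)
      refine Nat.cast_le.2 (card_le_card (monotone_filter_right _ fun B _ hB => ?_))
      exact hB ▸ inter_subset_right
    calc ((bad Y).card : ℝ)
        ≤ ∑ B ∈ 𝓛.filter (fun B => A ∩ B = Y), ((sup (A ∪ B)).card : ℝ) := by
          exact_mod_cast card_biUnion_le
      _ ≤ (𝓛.filter fun B => A ∩ B = Y).card * (n : ℝ) ^ ((k : ℝ) - 2 * t + Y.card) := by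
          rw [← nsmul_eq_mul]
          exact sum_le_card_nsmul _ _ _ hsup
      _ ≤ C * (n : ℝ) ^ ((t : ℝ) - (Y.card : ℝ) - ε) * (n : ℝ) ^ ((k : ℝ) - 2 * t + Y.card) := by
          gcongr
      _ = C * (n : ℝ) ^ ((k : ℝ) - (t : ℝ) - ε) := by
          rw [mul_assoc, ← Real.rpow_add hn]
          congr 2
          ring
  have hcover : sup A ⊆ ((powersetCard k X).filter
      fun S => A ⊆ S ∧ ∀ B ∈ 𝓛, B ≠ A → ¬ B ⊆ S) ∪ A.ssubsets.biUnion bad := by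
    intro S hS
    obtain ⟨hSX, hAS⟩ := mem_filter.1 hS
    by_cases h : ∀ B ∈ 𝓛, B ≠ A → ¬ B ⊆ S
    · exact mem_union_left _ (mem_filter.2 ⟨hSX, hAS, h⟩)
    · push Not at h
      obtain ⟨B, hB, hBA, hBS⟩ := h
      refine mem_union_right _ (mem_biUnion.2 ⟨A ∩ B, ?_, mem_biUnion.2
        ⟨B, mem_filter.2 ⟨hB, rfl⟩, mem_filter.2 ⟨hSX, union_subset hAS hBS⟩⟩⟩)
      refine mem_ssubsets.2 (inter_subset_left.ssubset_of_ne fun h => hBA ?_)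
      exact (eq_of_subset_of_card_le (inter_eq_left.1 h) (by rw [hAt, (hmem B hB).2])).symm
  have htotal : (sup A).card = (n - t).choose (k - t) := by
    have := card_filter_powersetCard_subset _ _ _ hAX (hAt.trans_le htk.le)
    rwa [hX, hAt] at this
  have hunion : ((A.ssubsets.biUnion bad).card : ℝ)
      ≤ 2 ^ t * C * (n : ℝ) ^ ((k : ℝ) - (t : ℝ) - ε) := by
    calc ((A.ssubsets.biUnion bad).card : ℝ)
        ≤ ∑ Y ∈ A.ssubsets, ((bad Y).card : ℝ) := by exact_mod_cast card_biUnion_le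
      _ ≤ A.ssubsets.card * (C * (n : ℝ) ^ ((k : ℝ) - (t : ℝ) - ε)) := by
          rw [← nsmul_eq_mul]
          exact sum_le_card_nsmul _ _ _ hbad
      _ ≤ 2 ^ t * (C * (n : ℝ) ^ ((k : ℝ) - (t : ℝ) - ε)) := by
          gcongr
          have : A.ssubsets.card ≤ 2 ^ t := by
            rw [← hAt, ← card_powerset]
            exact card_le_card (erase_subset _ _)
          exact_mod_cast this
      _ = _ := by ring
  have hle : ((sup A).card : ℝ) ≤ _ :=
    Nat.cast_le.2 ((card_le_card hcover).trans (card_union_le _ _))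
  rw [htotal, Nat.cast_add] at hle
  linarith
end

section
/- Let n, k, t, s be positive integers with n ≥ k > t, let X be an n-element set, let A be a t-element subset of X, and let 𝓢 be a family of k-element subsets of X each containing A. If |𝓢| > Σ_{i=1}^{k−t} C(k·s, i) · C(n, k − t − i), where C(a,b) denotes the binomial coefficient, then there exist s distinct members C₁, …, C_s of 𝓢 such that C_i ∩ C_j = A for all i ≠ j. -/
open Finset

/-- A family of `k`-sets between `A` and `X`, all of which meet a set `U` disjoint from `A`, is
bounded by counting each member `C` through the pair `(C ∩ U, C \ (A ∪ U))`. -/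
theorem card_le_of_forall_inter_nonempty {α : Type*} [DecidableEq α] {k N : ℕ}
    {X A U : Finset α} {F : Finset (Finset α)}
    (hF : ∀ C ∈ F, C ⊆ X ∧ C.card = k ∧ A ⊆ C) (hAU : Disjoint A U) (hU : U.card ≤ N)
    (hmeet : ∀ C ∈ F, (C ∩ U).Nonempty) :
    F.card ≤ ∑ i ∈ Icc 1 (k - A.card), N.choose i * X.card.choose (k - A.card - i) := by
  have hsub : F ⊆ (Icc 1 (k - A.card)).biUnion fun i =>
      (powersetCard i U ×ˢ powersetCard (k - A.card - i) X).image fun p => A ∪ p.1 ∪ p.2 := by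
    intro C hC
    obtain ⟨hCX, hCk, hAC⟩ := hF C hC
    have hsplit : (C ∩ U).card + ((C \ A) \ U).card = k - A.card := by
      have hCU : (C \ A) ∩ U = C ∩ U := by
        ext x
        have := fun hx : x ∈ A => disjoint_left.1 hAU hx
        simp only [mem_inter, mem_sdiff]
        tauto
      rw [← hCU, card_inter_add_card_sdiff, card_sdiff_of_subset hAC, hCk]
    have hpos := (hmeet C hC).card_pos
    simp only [mem_biUnion, mem_image, mem_product, mem_powersetCard, mem_Icc]
    refine ⟨(C ∩ U).card, ⟨hpos, by omega⟩, (C ∩ U, (C \ A) \ U),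
      ⟨⟨inter_subset_right, rfl⟩, (sdiff_subset.trans sdiff_subset).trans hCX, Nat.eq_sub_of_add_eq' hsplit⟩, ?_⟩
    ext x
    have := @hAC x
    simp only [mem_union, mem_inter, mem_sdiff]
    tauto
  refine (card_le_card hsub).trans (card_biUnion_le.trans (sum_le_sum fun i _ => ?_))
  refine card_image_le.trans ?_
  rw [card_product, card_powersetCard, card_powersetCard]
  exact Nat.mul_le_mul_right _ (Nat.choose_le_choose i hU)

/-- A small subfamily of a large family that pairwise intersects in `A` can be grown greedily
up to `s` members. -/
theorem exists_pairwise_inter_eq_of_card_lt {α : Type*} [DecidableEq α] {k s : ℕ}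
    {X A : Finset α} {F : Finset (Finset α)} (hAk : A.card < k)
    (hF : ∀ C ∈ F, C ⊆ X ∧ C.card = k ∧ A ⊆ C)
    (hbig : ∑ i ∈ Icc 1 (k - A.card), (k * s).choose i * X.card.choose (k - A.card - i) < F.card)
    (m : ℕ) (hm : m ≤ s) :
    ∃ T ⊆ F, T.card = m ∧ (T : Set (Finset α)).Pairwise fun C D => C ∩ D = A := by
  induction m with
  | zero => exact ⟨∅, empty_subset _, rfl, by simp⟩
  | succ m ih =>
    obtain ⟨T, hTF, hTm, hT⟩ := ih (by omega)
    set U := T.biUnion fun C => C \ A with hUdef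
    have hAU : Disjoint A U := by
      rw [hUdef, disjoint_biUnion_right]
      exact fun C _ => disjoint_sdiff
    have hU : U.card ≤ k * s := by
      calc U.card ≤ T.card * k := card_biUnion_le_card_mul _ _ _ fun C hC =>
            (card_le_card sdiff_subset).trans (hF C (hTF hC)).2.1.le
        _ ≤ k * s := by
            rw [hTm, mul_comm]
            exact Nat.mul_le_mul_left k (by omega)
    obtain ⟨C, hC, hCU⟩ : ∃ C ∈ F, C ∩ U = ∅ := by
      by_contra! h
      exact hbig.not_ge (card_le_of_forall_inter_nonempty hF hAU hU h)
    obtain ⟨-, hCk, hAC⟩ := hF C hC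
    have hCD : ∀ D ∈ T, C ∩ D = A := by
      intro D hD
      refine Subset.antisymm (fun x hx => ?_) (subset_inter hAC (hF D (hTF hD)).2.2)
      by_contra hxA
      have hxC := mem_inter.1 hx
      have hxU : x ∈ C ∩ U :=
        mem_inter.2 ⟨hxC.1, mem_biUnion.2 ⟨D, hD, mem_sdiff.2 ⟨hxC.2, hxA⟩⟩⟩
      simp [hCU] at hxU
    have hCT : C ∉ T := by
      intro h
      have hCA := hCD C h
      rw [inter_self] at hCA
      rw [hCA] at hCk
      omega
    refine ⟨insert C T, insert_subset hC hTF, by rw [card_insert_of_notMem hCT, hTm], ?_⟩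
    rw [coe_insert]
    refine hT.insert fun D hD _ => ⟨hCD D hD, ?_⟩
    rw [inter_comm]
    exact hCD D hD

/-- If a family `𝓢` of `k`-element subsets of an `n`-element set, each containing a fixed
`t`-set `A`, has more than `Σ_{i=1}^{k-t} C(k·s, i) · C(n, k-t-i)` members, then it contains
`s` distinct members pairwise intersecting exactly in `A`. -/
theorem sunflower_in_large_family {α : Type*} [DecidableEq α]
    (n k t s : ℕ) (hn : 0 < n) (hk : 0 < k) (ht : 0 < t) (hs : 0 < s)
    (hkn : k ≤ n) (htk : t < k)
    (X : Finset α) (hX : X.card = n)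
    (A : Finset α) (hAX : A ⊆ X) (hAcard : A.card = t)
    (𝓢 : Finset (Finset α)) (h𝓢 : ∀ C ∈ 𝓢, C ⊆ X ∧ C.card = k ∧ A ⊆ C)
    (hbig : (∑ i ∈ Finset.Icc 1 (k - t), (k * s).choose i * n.choose (k - t - i)) < 𝓢.card) :
    ∃ f : Fin s → Finset α, Function.Injective f ∧ (∀ i, f i ∈ 𝓢) ∧
      ∀ i j : Fin s, i ≠ j → f i ∩ f j = A := by
  subst hX hAcard
  obtain ⟨T, hTS, hTs, hT⟩ := exists_pairwise_inter_eq_of_card_lt htk h𝓢 hbig s le_rfl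
  let e := (T.equivFinOfCardEq hTs).symm
  have he : Function.Injective fun i => (e i : Finset α) :=
    Subtype.val_injective.comp e.injective
  exact ⟨fun i => e i, he, fun i => hTS (e i).2,
    fun i j hij => hT (e i).2 (e j).2 (he.ne hij)⟩
end

section
/- Let X be an n-element set, let k > t ≥ 1 be integers, let A' be a k-element subset of X, and let B be a t-element subset of X with |A' ∩ B| = ℓ where ℓ < t. Then the number of k-element subsets C of X with B ⊆ C and |A' ∩ C| ≥ t equals Σ_{i=t−ℓ}^{k−t} C(k−ℓ, i) · C(n − k − t + ℓ, k − t − i), where C(a,b) denotes the binomial coefficient. In particular this number is at most 2^k · n^{k−2t+ℓ} for n ≥ k. -/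
open Finset

/-- The `k`-element subsets of `X` that contain `B` and meet `S` in exactly `i` elements, for
disjoint `B`, `S`, are determined by their traces on `S` and on `X \ (S ∪ B)`. -/
theorem card_filter_superset_card_inter_eq {α : Type*} [DecidableEq α] {X B S : Finset α}
    (hB : B ⊆ X) (hS : S ⊆ X) (hSB : Disjoint S B) {k i : ℕ} (hk : B.card + i ≤ k) :
    ((powersetCard k X).filter fun C => B ⊆ C ∧ (S ∩ C).card = i).card =
      S.card.choose i * (X \ (S ∪ B)).card.choose (k - B.card - i) := by
  rw [← card_powersetCard, ← card_powersetCard, ← card_product]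
  refine card_nbij' (fun C => (S ∩ C, C \ (S ∪ B))) (fun p => B ∪ (p.1 ∪ p.2)) ?_ ?_ ?_ ?_
  · intro C hC
    simp only [coe_filter, mem_powersetCard, Set.mem_ofPred_eq] at hC
    obtain ⟨⟨hCX, hCk⟩, hBC, hi⟩ := hC
    have h1 : (C ∩ (S ∪ B)).card = i + B.card := by
      rw [show C ∩ (S ∪ B) = (S ∩ C) ∪ B by grind, card_union_of_disjoint (hSB.mono_left
        inter_subset_left), hi]
    have h2 := card_sdiff_add_card_inter C (S ∪ B)
    simp only [coe_product, Set.mem_prod, mem_coe, mem_powersetCard]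
    exact ⟨⟨inter_subset_left, hi⟩, sdiff_subset_sdiff hCX subset_rfl, by omega⟩
  · rintro ⟨P, Q⟩ h
    simp only [coe_product, Set.mem_prod, mem_coe, mem_powersetCard] at h
    obtain ⟨⟨hPS, hP⟩, hQX, hQ⟩ := h
    rw [disjoint_left] at hSB
    have hPQ : Disjoint P Q := by rw [disjoint_left]; grind
    have hBPQ : Disjoint B (P ∪ Q) := by rw [disjoint_left]; grind
    simp only [coe_filter, mem_powersetCard, Set.mem_ofPred_eq]
    refine ⟨⟨by grind, ?_⟩, subset_union_left, ?_⟩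
    · rw [card_union_of_disjoint hBPQ, card_union_of_disjoint hPQ]
      omega
    · rw [show S ∩ (B ∪ (P ∪ Q)) = P by grind, hP]
  · intro C hC
    simp only [coe_filter, Set.mem_ofPred_eq] at hC
    grind
  · rintro ⟨P, Q⟩ h
    simp only [coe_product, Set.mem_prod, mem_coe, mem_powersetCard] at h
    rw [disjoint_left] at hSB
    ext x <;> grind

/-- A polynomial bound for the sum of products of binomial coefficients over `[a, b]`. -/
theorem sum_Icc_choose_mul_choose_le {m n N a b : ℕ} (hm : m ≤ n) (hn : 0 < n) :
    ∑ i ∈ Icc a b, N.choose i * m.choose (b - i) ≤ 2 ^ N * n ^ (b - a) := by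
  calc ∑ i ∈ Icc a b, N.choose i * m.choose (b - i)
      ≤ ∑ i ∈ Icc a b, N.choose i * n ^ (b - a) := by
        refine sum_le_sum fun i hi => Nat.mul_le_mul_left _ ?_
        rw [mem_Icc] at hi
        calc m.choose (b - i) ≤ m ^ (b - i) := Nat.choose_le_pow _ _
          _ ≤ n ^ (b - i) := Nat.pow_le_pow_left hm _
          _ ≤ n ^ (b - a) := Nat.pow_le_pow_right hn (by omega)
    _ = (∑ i ∈ Icc a b, N.choose i) * n ^ (b - a) := (sum_mul _ _ _).symm
    _ ≤ 2 ^ N * n ^ (b - a) := by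
        refine Nat.mul_le_mul_right _ ?_
        rw [← Nat.sum_range_choose]
        refine sum_le_sum_of_ne_zero fun i _ h => ?_
        have := mt Nat.choose_eq_zero_of_lt h
        rw [mem_range]
        omega

/-- The number of `k`-element subsets `C` of an `n`-element set `X` with `B ⊆ C` and
`|A' ∩ C| ≥ t`, where `|A'| = k`, `|B| = t`, `|A' ∩ B| = ℓ < t`, equals
`Σ_{i=t-ℓ}^{k-t} C(k-ℓ, i) · C(n-k-t+ℓ, k-t-i)`; in particular it is at most
`2^k · n^(k-2t+ℓ)` for `n ≥ k`. -/
theorem count_intersecting_continuations {α : Type*} [DecidableEq α]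
    (n k t ℓ : ℕ) (ht : 1 ≤ t) (htk : t < k) (hkn : k ≤ n)
    (X : Finset α) (hX : X.card = n)
    (A' B : Finset α) (hA'X : A' ⊆ X) (hA'card : A'.card = k)
    (hBX : B ⊆ X) (hBcard : B.card = t)
    (hℓ : (A' ∩ B).card = ℓ) (hℓt : ℓ < t) :
    ((Finset.powersetCard k X).filter fun C => B ⊆ C ∧ t ≤ (A' ∩ C).card).card =
      (∑ i ∈ Finset.Icc (t - ℓ) (k - t),
        (k - ℓ).choose i * (n - (k + t - ℓ)).choose (k - t - i)) ∧
    (((Finset.powersetCard k X).filter fun C => B ⊆ C ∧ t ≤ (A' ∩ C).card).card : ℝ) ≤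
      2 ^ k * (n : ℝ) ^ ((k : ℝ) - 2 * (t : ℝ) + (ℓ : ℝ)) := by
  have hSX : A' \ B ⊆ X := sdiff_subset.trans hA'X
  have hSB : Disjoint (A' \ B) B := sdiff_disjoint
  have hScard : (A' \ B).card = k - ℓ := by
    have := card_sdiff_add_card_inter A' B
    omega
  have hℓk : ℓ ≤ k := by omega
  have hrest : (X \ (A' \ B ∪ B)).card = n - (k + t - ℓ) := by
    rw [card_sdiff_of_subset (union_subset hSX hBX), card_union_of_disjoint hSB]
    omega
  have hcount : ((Finset.powersetCard k X).filter fun C => B ⊆ C ∧ t ≤ (A' ∩ C).card).card =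
      ∑ i ∈ Finset.Icc (t - ℓ) (k - t),
        (k - ℓ).choose i * (n - (k + t - ℓ)).choose (k - t - i) := by
    have key : ∀ C, B ⊆ C → (A' ∩ C).card = ((A' \ B) ∩ C).card + ℓ := by
      intro C hBC
      rw [← hℓ, ← card_union_of_disjoint (by rw [disjoint_left]; grind)]
      congr 1
      grind
    rw [card_eq_sum_card_fiberwise (f := fun C => ((A' \ B) ∩ C).card)
      (t := Finset.Icc (t - ℓ) (k - t))]
    · refine sum_congr rfl fun i hi => ?_
      rw [mem_Icc] at hi
      rw [← hScard, ← hrest, ← hBcard,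
        ← card_filter_superset_card_inter_eq hBX hSX hSB (by omega), filter_filter]
      congr 1
      refine filter_congr fun C _ => ?_
      constructor
      · rintro ⟨⟨h1, -⟩, h2⟩
        exact ⟨h1, h2⟩
      · rintro ⟨h1, h2⟩
        have := key C h1
        exact ⟨⟨h1, by omega⟩, h2⟩
    · intro C hC
      simp only [coe_filter, mem_powersetCard, Set.mem_ofPred_eq] at hC
      obtain ⟨⟨-, hCk⟩, hBC, htC⟩ := hC
      have h1 := key C hBC
      have h2 : ((A' \ B) ∩ C).card + B.card ≤ C.card := by
        rw [← card_union_of_disjoint (hSB.mono_left inter_subset_left)]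
        exact card_le_card (union_subset inter_subset_right hBC)
      simp only [coe_Icc, Set.mem_Icc]
      omega
  refine ⟨hcount, ?_⟩
  rw [hcount]
  by_cases hle : t - ℓ ≤ k - t
  · have hn : 0 < n := by omega
    have hexp : (k : ℝ) - 2 * (t : ℝ) + (ℓ : ℝ) = ((k - t - (t - ℓ) : ℕ) : ℝ) := by
      rw [Nat.cast_sub hle, Nat.cast_sub htk.le, Nat.cast_sub hℓt.le]
      ring
    rw [hexp, Real.rpow_natCast]
    have hbound := (sum_Icc_choose_mul_choose_le (N := k - ℓ) (a := t - ℓ) (b := k - t)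
      (Nat.sub_le n (k + t - ℓ)) hn).trans
      (Nat.mul_le_mul_right _ (Nat.pow_le_pow_right two_pos (Nat.sub_le k ℓ)))
    exact_mod_cast hbound
  · rw [Icc_eq_empty hle, sum_empty, Nat.cast_zero]
    positivity
end

section
/- Let X be a finite set, let k > t ≥ 1 be integers, let A be a t-element subset of X, and let 𝓠 be a family of k-element subsets of X, each containing A, such that Q₁ ∩ Q₂ = A for every two distinct Q₁, Q₂ ∈ 𝓠. Let C be a k-element subset of X with A ⊄ C. Then the number of members A' ∈ 𝓠 with |A' ∩ C| ≥ t is at most k. -/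
open Finset

/-- If `𝓠` is a family of `k`-element subsets of `X`, each containing a `t`-set `A`, pairwise
intersecting exactly in `A`, and `C` is a `k`-element subset of `X` not containing `A`, then
at most `k` members `A' ∈ 𝓠` satisfy `|A' ∩ C| ≥ t`. -/
theorem lipschitz_bound {α : Type*} [DecidableEq α]
    (X : Finset α) (k t : ℕ) (ht : 1 ≤ t) (htk : t < k)
    (A : Finset α) (hAX : A ⊆ X) (hAcard : A.card = t)
    (𝓠 : Finset (Finset α)) (h𝓠 : ∀ Q ∈ 𝓠, Q ⊆ X ∧ Q.card = k ∧ A ⊆ Q)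
    (hpair : ∀ Q₁ ∈ 𝓠, ∀ Q₂ ∈ 𝓠, Q₁ ≠ Q₂ → Q₁ ∩ Q₂ = A)
    (C : Finset α) (hCX : C ⊆ X) (hCcard : C.card = k) (hAC : ¬ A ⊆ C) :
    (𝓠.filter fun A' => t ≤ (A' ∩ C).card).card ≤ k := by
  rw [← hCcard]
  refine card_le_card_of_forall_subsingleton (fun Q x => x ∈ Q ∧ x ∉ A) ?_ ?_
  · intro Q hQ
    have hQC : ¬ Q ∩ C ⊆ A := fun hsub =>
      hAC (eq_of_subset_of_card_le hsub (hAcard.trans_le (mem_filter.1 hQ).2) ▸ inter_subset_right)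
    obtain ⟨x, hx, hxA⟩ := not_subset.1 hQC
    exact ⟨x, (mem_inter.1 hx).2, (mem_inter.1 hx).1, hxA⟩
  · rintro x - Q₁ ⟨hQ₁, hx₁, hxA⟩ Q₂ ⟨hQ₂, hx₂, -⟩
    by_contra hne
    have hinter := hpair Q₁ (mem_filter.1 hQ₁).1 Q₂ (mem_filter.1 hQ₂).1 hne
    exact hxA (hinter ▸ mem_inter.2 ⟨hx₁, hx₂⟩)
end

section
/- For all integers k > t ≥ 2, all reals ε ∈ (0,1) and C > 0, there exists n₀ such that for every n ≥ n₀ the following holds. Let X be an n-element set and let 𝓛 be a family of t-element subsets of X such that for every integer ℓ with 0 ≤ ℓ < t, every ℓ-element subset of X is contained in at most C · n^{t−ℓ−ε} members of 𝓛. Then there exists a function φ assigning to each A ∈ 𝓛 a k-element subset φ(A) of X with A ⊆ φ(A), such that |φ(A) ∩ φ(B)| < t for every two distinct A, B ∈ 𝓛. -/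
open Finset

/-- If the variables `f a` range over finite sets of common size `N` and, for each `a`, the number
of bad pairs `(f a, f b)`, summed over `b ≠ a`, is at most `N ^ 2 / 4`, then some assignment has no
bad pair. -/
theorem exists_forall_mem_pairwise_not {ι α : Type*} [Fintype ι] [DecidableEq ι]
    (opt : ι → Finset α) {N : ℕ} (hN : 0 < N) (hcard : ∀ a, #(opt a) = N)
    (R : α → α → Prop) [DecidableRel R] (hR : ∀ x y, R x y → R y x)
    (h : ∀ a, 4 * ∑ b ∈ univ.erase a, #{p ∈ opt a ×ˢ opt b | R p.1 p.2} ≤ N ^ 2) :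
    ∃ f : ι → α, (∀ a, f a ∈ opt a) ∧ ∀ a b, a ≠ b → ¬ R (f a) (f b) := by
  classical
  let V : Finset ι → (ι → α) → Prop := fun S f => ∀ a ∈ S, ∀ b ∈ S, a ≠ b → ¬ R (f a) (f b)
  let Z : Finset ι → Finset (ι → α) := fun S => {f ∈ Fintype.piFinset opt | V S f}
  let bad : ι → ι → ℕ := fun a b => #{p ∈ opt a ×ˢ opt b | R p.1 p.2}
  have indep (S : Finset ι) (a b : ι) (ha : a ∉ S) (hb : b ∉ S) (hab : a ≠ b) :
      #{f ∈ Z S | R (f a) (f b)} * N ^ 2 ≤ #(Z S) * bad a b := by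
    have hopt : N ^ 2 = #(opt a ×ˢ opt b) := by rw [card_product, hcard, hcard, sq]
    rw [hopt, ← card_product, ← card_product]
    refine card_le_card_of_injOn
      (fun q => (Function.update (Function.update q.1 a q.2.1) b q.2.2, (q.1 a, q.1 b))) ?_ ?_
    · rintro ⟨f, x, y⟩ hq
      simp only [Z, V, coe_product, Set.mem_prod, mem_coe, mem_filter, Fintype.mem_piFinset,
        mem_product] at hq ⊢
      obtain ⟨⟨⟨hf, hV⟩, hRf⟩, hx, hy⟩ := hq
      refine ⟨⟨fun c => ?_, fun c hc d hd hcd => ?_⟩, ⟨hf a, hf b⟩, hRf⟩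
      · by_cases hcb : c = b
        · subst hcb; simpa using hy
        · by_cases hca : c = a
          · subst hca; simpa [hcb] using hx
          · simpa [hcb, hca] using hf c
      · have h1 : c ≠ a := by rintro rfl; exact ha hc
        have h2 : c ≠ b := by rintro rfl; exact hb hc
        have h3 : d ≠ a := by rintro rfl; exact ha hd
        have h4 : d ≠ b := by rintro rfl; exact hb hd
        simpa [h1, h2, h3, h4] using hV c hc d hd hcd
    · rintro ⟨f, x, y⟩ - ⟨f', x', y'⟩ - hq
      simp only [Prod.mk.injEq] at hq ⊢
      obtain ⟨hu, hfa, hfb⟩ := hq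
      refine ⟨funext fun c => ?_, ?_, ?_⟩
      · by_cases hcb : c = b
        · rw [hcb, hfb]
        · by_cases hca : c = a
          · rw [hca, hfa]
          · simpa [hcb, hca] using congrFun hu c
      · simpa [hab] using congrFun hu a
      · simpa using congrFun hu b
  have step : ∀ S : Finset ι, ∀ a ∉ S, #(Z S) ≤ 2 * #(Z (insert a S)) := by
    intro S
    induction S using Finset.strongInduction with
    | H S ih =>
      intro a ha
      have hcover : Z S ⊆ Z (insert a S) ∪
          S.biUnion fun b => {f ∈ Z (S.erase b) | R (f a) (f b)} := by
        intro f hf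
        simp only [Z, mem_filter] at hf
        by_cases hbad : ∃ b ∈ S, R (f a) (f b)
        · obtain ⟨b, hb, hRb⟩ := hbad
          refine mem_union_right _ (mem_biUnion.2 ⟨b, hb, ?_⟩)
          simp only [Z, mem_filter]
          exact ⟨⟨hf.1, fun c hc d hd => hf.2 c (mem_of_mem_erase hc) d (mem_of_mem_erase hd)⟩, hRb⟩
        · push Not at hbad
          refine mem_union_left _ ?_
          simp only [Z, mem_filter]
          refine ⟨hf.1, fun c hc d hd hcd => ?_⟩
          rcases mem_insert.1 hc with rfl | hcS
          · rcases mem_insert.1 hd with rfl | hdS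
            · exact absurd rfl hcd
            · exact hbad d hdS
          · rcases mem_insert.1 hd with rfl | hdS
            · exact fun hr => hbad c hcS (hR _ _ hr)
            · exact hf.2 c hcS d hdS hcd
      have hle : #(Z S) ≤ #(Z (insert a S)) +
          ∑ b ∈ S, #{f ∈ Z (S.erase b) | R (f a) (f b)} :=
        (card_le_card hcover).trans ((card_union_le _ _).trans
          (Nat.add_le_add_left card_biUnion_le _))
      have hbound : (2 * ∑ b ∈ S, #{f ∈ Z (S.erase b) | R (f a) (f b)}) * N ^ 2
          ≤ #(Z S) * N ^ 2 := by
        calc (2 * ∑ b ∈ S, #{f ∈ Z (S.erase b) | R (f a) (f b)}) * N ^ 2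
            = 2 * ∑ b ∈ S, #{f ∈ Z (S.erase b) | R (f a) (f b)} * N ^ 2 := by
              rw [mul_assoc, sum_mul]
          _ ≤ 2 * ∑ b ∈ S, (2 * #(Z S)) * bad a b := by
              gcongr 2 * ?_
              refine sum_le_sum fun b hb => ?_
              refine (indep (S.erase b) a b (fun hh => ha (mem_of_mem_erase hh))
                (notMem_erase b S) (by rintro rfl; exact ha hb)).trans ?_
              have := ih (S.erase b) (erase_ssubset hb) b (notMem_erase b S)
              rw [insert_erase hb] at this
              gcongr
          _ = #(Z S) * (4 * ∑ b ∈ S, bad a b) := by rw [← mul_sum]; ring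
          _ ≤ #(Z S) * (4 * ∑ b ∈ univ.erase a, bad a b) := by
              gcongr
              intro b hb
              exact mem_erase.2 ⟨by rintro rfl; exact ha hb, mem_univ b⟩
          _ ≤ #(Z S) * N ^ 2 := by gcongr; exact h a
      have := Nat.le_of_mul_le_mul_right hbound (by positivity)
      omega
  have hpos : ∀ S : Finset ι, 0 < #(Z S) := by
    intro S
    induction S using Finset.induction_on with
    | empty =>
      refine card_pos.2 ?_
      have hne : (Fintype.piFinset opt).Nonempty :=
        Fintype.piFinset_nonempty.2 fun a => card_pos.1 (by rw [hcard]; exact hN)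
      simpa [Z, V] using hne
    | insert a S ha ih => have := step S a ha; omega
  obtain ⟨f, hf⟩ := card_pos.1 (hpos univ)
  simp only [Z, V, mem_filter, Fintype.mem_piFinset] at hf
  exact ⟨f, hf.1, fun a b => hf.2 a (mem_univ a) b (mem_univ b)⟩

/-- The `k`-element sets containing `D`. -/
def supersetsCard {α : Type*} [Fintype α] [DecidableEq α] (k : ℕ) (D : Finset α) :
    Finset (Finset α) :=
  {Q | #Q = k ∧ D ⊆ Q}

section supersetsCard

variable {α : Type*} [Fintype α] [DecidableEq α] {k : ℕ}

theorem mem_supersetsCard {D Q : Finset α} : Q ∈ supersetsCard k D ↔ #Q = k ∧ D ⊆ Q := by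
  simp [supersetsCard]

theorem card_supersetsCard {D : Finset α} (hD : #D ≤ k) :
    #(supersetsCard k D) = (Fintype.card α - #D).choose (k - #D) := by
  rw [← card_compl, ← card_powersetCard]
  refine card_bij' (fun Q _ => Q \ D) (fun U _ => U ∪ D) ?_ ?_ ?_ ?_
  · intro Q hQ
    rw [mem_supersetsCard] at hQ
    rw [mem_powersetCard, card_sdiff_of_subset hQ.2, hQ.1]
    exact ⟨fun x hx => by simpa using (mem_sdiff.1 hx).2, rfl⟩
  · intro U hU
    rw [mem_powersetCard] at hU
    have hdisj : Disjoint U D := disjoint_left.2 fun x hx => by simpa using hU.1 hx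
    rw [mem_supersetsCard, card_union_of_disjoint hdisj, hU.2]
    exact ⟨by omega, subset_union_right⟩
  · intro Q hQ
    rw [mem_supersetsCard] at hQ
    exact sdiff_union_of_subset hQ.2
  · intro U hU
    rw [mem_powersetCard] at hU
    have hdisj : Disjoint U D := disjoint_left.2 fun x hx => by simpa using hU.1 hx
    rw [union_sdiff_right, sdiff_eq_self_of_disjoint hdisj]

theorem card_supersetsCard_insert_mul_le (hk : 2 * k ≤ Fintype.card α) {x : α} {D : Finset α}
    (hx : x ∉ D) :
    #(supersetsCard k (insert x D)) * Fintype.card α ≤ 2 * k * #(supersetsCard k D) := by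
  rcases lt_or_ge #D k with hlt | hge
  · rw [card_supersetsCard hlt.le, card_supersetsCard (by rw [card_insert_of_notMem hx]; exact hlt),
      card_insert_of_notMem hx]
    obtain ⟨s, hs⟩ : ∃ s, k = #D + (s + 1) := ⟨k - #D - 1, by omega⟩
    obtain ⟨m, hm⟩ : ∃ m, Fintype.card α = #D + (m + 1) := ⟨Fintype.card α - #D - 1, by omega⟩
    have e1 : Fintype.card α - (#D + 1) = m := by omega
    have e2 : k - (#D + 1) = s := by omega
    have e3 : Fintype.card α - #D = m + 1 := by omega
    have e4 : k - #D = s + 1 := by omega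
    rw [e1, e2, e3, e4]
    have hchoose := Nat.add_one_mul_choose_eq m s
    calc m.choose s * Fintype.card α ≤ m.choose s * (2 * (m + 1)) := by gcongr; omega
      _ = 2 * (s + 1) * (m + 1).choose (s + 1) := by linarith
      _ ≤ 2 * k * (m + 1).choose (s + 1) := by gcongr; omega
  · have : supersetsCard k (insert x D) = ∅ := by
      refine eq_empty_of_forall_notMem fun Q hQ => ?_
      rw [mem_supersetsCard] at hQ
      have := card_le_card hQ.2
      rw [card_insert_of_notMem hx] at this
      omega
    simp [this]

theorem card_supersetsCard_union_mul_le (hk : 2 * k ≤ Fintype.card α) (B U : Finset α)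
    (hBU : Disjoint U B) :
    #(supersetsCard k (B ∪ U)) * Fintype.card α ^ #U ≤ (2 * k) ^ #U * #(supersetsCard k B) := by
  induction U using Finset.induction_on with
  | empty => simp
  | insert x U hx ih =>
    rw [disjoint_insert_left] at hBU
    rw [card_insert_of_notMem hx, union_insert]
    calc #(supersetsCard k (insert x (B ∪ U))) * Fintype.card α ^ (#U + 1)
        = #(supersetsCard k (insert x (B ∪ U))) * Fintype.card α * Fintype.card α ^ #U := by ring
      _ ≤ 2 * k * #(supersetsCard k (B ∪ U)) * Fintype.card α ^ #U := by
          exact Nat.mul_le_mul_right _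
            (card_supersetsCard_insert_mul_le hk (by simp [hx, hBU.1]))
      _ = 2 * k * (#(supersetsCard k (B ∪ U)) * Fintype.card α ^ #U) := by ring
      _ ≤ 2 * k * ((2 * k) ^ #U * #(supersetsCard k B)) := Nat.mul_le_mul_left _ (ih hBU.2)
      _ = (2 * k) ^ (#U + 1) * #(supersetsCard k B) := by ring

/-- A pair of `k`-sets `P ⊇ A`, `Q ⊇ B` meeting in at least `t = #B` points either has `B ⊆ P`, or
`Q` contains a `t`-subset `T ≠ B` of `P`. -/
theorem card_filter_le_card_inter_le (A B : Finset α) :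
    #{p ∈ supersetsCard k A ×ˢ supersetsCard k B | #B ≤ #(p.1 ∩ p.2)} ≤
      (∑ P ∈ supersetsCard k A, ∑ T ∈ powersetCard #B P,
        if B = T then 0 else #(supersetsCard k (B ∪ T))) +
      #(supersetsCard k (A ∪ B)) * #(supersetsCard k B) := by
  have hsub : {p ∈ supersetsCard k A ×ˢ supersetsCard k B | #B ≤ #(p.1 ∩ p.2)} ⊆
      ((supersetsCard k A).biUnion fun P => (powersetCard #B P).biUnion fun T =>
        if B = T then ∅ else {P} ×ˢ supersetsCard k (B ∪ T)) ∪
      supersetsCard k (A ∪ B) ×ˢ supersetsCard k B := by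
    rintro ⟨P, Q⟩ hPQ
    simp only [mem_filter, mem_product] at hPQ
    obtain ⟨⟨hP, hQ⟩, hcard⟩ := hPQ
    obtain ⟨T, hT, hTcard⟩ := exists_subset_card_eq hcard
    rw [subset_inter_iff] at hT
    by_cases hBT : B = T
    · refine mem_union_right _ (mem_product.2 ⟨?_, hQ⟩)
      rw [mem_supersetsCard] at hP ⊢
      exact ⟨hP.1, union_subset hP.2 (hBT ▸ hT.1)⟩
    · refine mem_union_left _ (mem_biUnion.2 ⟨P, hP, mem_biUnion.2 ⟨T, ?_, ?_⟩⟩)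
      · exact mem_powersetCard.2 ⟨hT.1, hTcard⟩
      · rw [if_neg hBT, mem_product, mem_singleton, mem_supersetsCard]
        rw [mem_supersetsCard] at hQ
        exact ⟨rfl, hQ.1, union_subset hQ.2 hT.2⟩
  refine (card_le_card hsub).trans ((card_union_le _ _).trans ?_)
  rw [card_product]
  gcongr
  refine card_biUnion_le.trans (sum_le_sum fun P _ => card_biUnion_le.trans
    (sum_le_sum fun T _ => ?_))
  split_ifs <;> simp

end supersetsCard

/-- Among edges `B ≠ T` of a sparse `t`-uniform hypergraph, the total number of `k`-sets containing
both `B` and `T` is a vanishing proportion of the number of `k`-sets containing a given `t`-set. -/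
theorem sum_card_supersetsCard_union_le {n k t : ℕ} (hkn : 2 * k ≤ n) (hk : 0 < k) {ε C : ℝ}
    {N : ℕ} {𝓛 : Finset (Finset (Fin n))} (h𝓛 : ∀ A ∈ 𝓛, #A = t)
    (hN : ∀ A ∈ 𝓛, #(supersetsCard k A) = N)
    (hdeg : ∀ ℓ : ℕ, ℓ < t → ∀ X' : Finset (Fin n), #X' = ℓ →
      (#{A ∈ 𝓛 | X' ⊆ A} : ℝ) ≤ C * (n : ℝ) ^ ((t : ℝ) - (ℓ : ℝ) - ε))
    (hC : 0 < C) {T : Finset (Fin n)} (hT : #T = t) :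
    (∑ B ∈ 𝓛, if B = T then (0 : ℝ) else #(supersetsCard k (B ∪ T))) ≤
      2 ^ t * C * (2 * k) ^ t * N * (n : ℝ) ^ (-ε) := by
  have hn : (0 : ℝ) < n := by exact_mod_cast (by omega : 0 < n)
  have hfiber (X' : Finset (Fin n)) (hX' : X' ∈ T.powerset) :
      (∑ B ∈ 𝓛 with B ∩ T = X', if B = T then (0 : ℝ) else #(supersetsCard k (B ∪ T))) ≤
        C * (2 * k) ^ t * N * (n : ℝ) ^ (-ε) := by
    rw [mem_powerset] at hX'
    have hrhs : 0 ≤ C * (2 * k) ^ t * N * (n : ℝ) ^ (-ε) := by positivity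
    rcases (card_le_card hX').lt_or_eq with hlt | heq
    · rw [hT] at hlt
      have hterm (B : Finset (Fin n)) (hB : B ∈ {B ∈ 𝓛 | B ∩ T = X'}) :
          (if B = T then (0 : ℝ) else #(supersetsCard k (B ∪ T))) ≤
            (2 * k) ^ t * N / (n : ℝ) ^ (t - #X') := by
        rw [mem_filter] at hB
        have hbd : (0 : ℝ) ≤ (2 * k) ^ t * N / (n : ℝ) ^ (t - #X') := by positivity
        split_ifs with hBT
        · exact hbd
        have hU : #(T \ B) = t - #X' := by
          rw [card_sdiff, hT, hB.2]
        have := card_supersetsCard_union_mul_le (k := k) (by simpa using hkn) B (T \ B)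
          sdiff_disjoint
        rw [union_sdiff_self_eq_union, hU, hN B hB.1, Fintype.card_fin] at this
        rw [le_div_iff₀ (by positivity)]
        have hle : (2 * k) ^ (t - #X') * N ≤ (2 * k) ^ t * N := by
          gcongr <;> omega
        exact_mod_cast this.trans hle
      have hcard : (#{B ∈ 𝓛 | B ∩ T = X'} : ℝ) ≤ C * (n : ℝ) ^ ((t : ℝ) - (#X' : ℝ) - ε) := by
        refine le_trans ?_ (hdeg #X' hlt X' rfl)
        gcongr with B hB
        rintro rfl
        exact inter_subset_left
      have hpow : (n : ℝ) ^ ((t : ℝ) - (#X' : ℝ) - ε) = (n : ℝ) ^ (t - #X') * (n : ℝ) ^ (-ε) := by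
        rw [← Real.rpow_natCast, ← Real.rpow_add hn, Nat.cast_sub hlt.le, sub_eq_add_neg]
      calc _ ≤ #{B ∈ 𝓛 | B ∩ T = X'} • ((2 * k) ^ t * N / (n : ℝ) ^ (t - #X')) :=
            sum_le_card_nsmul _ _ _ hterm
        _ ≤ C * (n : ℝ) ^ ((t : ℝ) - (#X' : ℝ) - ε) *
              ((2 * k) ^ t * N / (n : ℝ) ^ (t - #X')) := by
            rw [nsmul_eq_mul]; gcongr
        _ = C * (2 * k) ^ t * N * (n : ℝ) ^ (-ε) := by
            rw [hpow]; field_simp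
    · have hXT := eq_of_subset_of_card_le hX' heq.ge
      refine (sum_nonpos fun B hB => ?_).trans hrhs
      rw [mem_filter, hXT] at hB
      rw [if_pos]
      exact (eq_of_subset_of_card_le (inter_eq_right.1 hB.2) (by rw [h𝓛 B hB.1, hT])).symm
  calc _ = ∑ X' ∈ T.powerset, ∑ B ∈ 𝓛 with B ∩ T = X',
          if B = T then (0 : ℝ) else #(supersetsCard k (B ∪ T)) :=
        (sum_fiberwise_of_maps_to (fun B _ => mem_powerset.2 inter_subset_right) _).symm
    _ ≤ #T.powerset • (C * (2 * k) ^ t * N * (n : ℝ) ^ (-ε)) := sum_le_card_nsmul _ _ _ hfiber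
    _ = 2 ^ t * C * (2 * k) ^ t * N * (n : ℝ) ^ (-ε) := by
        rw [card_powerset, hT, nsmul_eq_mul]; push_cast; ring

/-- For all `k > t ≥ 2`, `ε ∈ (0,1)` and `C > 0`, for all sufficiently large `n`: any
`t`-uniform hypergraph `𝓛` on `n` vertices in which every `ℓ`-set (`0 ≤ ℓ < t`) lies in at
most `C · n^(t-ℓ-ε)` edges admits a choice `φ(A) ⊇ A` of `k`-sets with pairwise intersections
of size less than `t`. -/
theorem choose_disjoint_continuations :
    ∀ k t : ℕ, t < k → 2 ≤ t → ∀ ε C : ℝ, 0 < ε → ε < 1 → 0 < C →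
      ∃ n₀ : ℕ, ∀ n : ℕ, n₀ ≤ n →
        ∀ 𝓛 : Finset (Finset (Fin n)),
          (∀ A ∈ 𝓛, A.card = t) →
          (∀ ℓ : ℕ, ℓ < t → ∀ X' : Finset (Fin n), X'.card = ℓ →
            ((𝓛.filter fun A => X' ⊆ A).card : ℝ) ≤ C * (n : ℝ) ^ ((t : ℝ) - (ℓ : ℝ) - ε)) →
          ∃ φ : Finset (Fin n) → Finset (Fin n),
            (∀ A ∈ 𝓛, (φ A).card = k ∧ A ⊆ φ A) ∧
            ∀ A ∈ 𝓛, ∀ B ∈ 𝓛, A ≠ B → (φ A ∩ φ B).card < t := by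
  intro k t htk ht ε C hε _ hC
  obtain ⟨n₁, hn₁⟩ : ∃ n₁ : ℕ, ∀ n : ℕ, n₁ ≤ n →
      4 * ((2 ^ k + 1) * (2 ^ t * C * (2 * k) ^ t)) * (n : ℝ) ^ (-ε) ≤ 1 := by
    have hlim : Filter.Tendsto (fun n : ℕ =>
        4 * ((2 ^ k + 1) * (2 ^ t * C * (2 * k) ^ t)) * (n : ℝ) ^ (-ε)) Filter.atTop
        (nhds (4 * ((2 ^ k + 1) * (2 ^ t * C * (2 * k) ^ t)) * 0)) :=
      ((tendsto_rpow_neg_atTop hε).comp tendsto_natCast_atTop_atTop).const_mul _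
    rw [mul_zero] at hlim
    exact Filter.eventually_atTop.1 (hlim.eventually_le_const one_pos)
  refine ⟨max n₁ (2 * k), fun n hn 𝓛 h𝓛 hdeg => ?_⟩
  have hkn : 2 * k ≤ n := (le_max_right _ _).trans hn
  set N := (n - t).choose (k - t) with hNdef
  have hNpos : 0 < N := Nat.choose_pos (by omega)
  have hN : ∀ A ∈ 𝓛, #(supersetsCard k A) = N := fun A hA => by
    rw [card_supersetsCard (by rw [h𝓛 A hA]; exact htk.le), h𝓛 A hA, Fintype.card_fin]
  have hsum {T : Finset (Fin n)} (hT : #T = t) :=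
    sum_card_supersetsCard_union_le hkn (by omega) h𝓛 hN hdeg hC hT
  have hbad (A : Finset (Fin n)) (hA : A ∈ 𝓛) :
      4 * ∑ B ∈ 𝓛.erase A,
        #{p ∈ supersetsCard k A ×ˢ supersetsCard k B | t ≤ #(p.1 ∩ p.2)} ≤ N ^ 2 := by
    set M : ℝ := 2 ^ t * C * (2 * k) ^ t * N * (n : ℝ) ^ (-ε) with hM
    have hM0 : 0 ≤ M := by positivity
    have hpair (B : Finset (Fin n)) (hB : B ∈ 𝓛.erase A) :
        (#{p ∈ supersetsCard k A ×ˢ supersetsCard k B | t ≤ #(p.1 ∩ p.2)} : ℝ) ≤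
          (∑ P ∈ supersetsCard k A, ∑ T ∈ powersetCard t P,
            if B = T then (0 : ℝ) else #(supersetsCard k (B ∪ T))) +
          (if B = A then (0 : ℝ) else #(supersetsCard k (B ∪ A))) * N := by
      rw [mem_erase] at hB
      have := card_filter_le_card_inter_le (k := k) A B
      rw [h𝓛 B hB.2, hN B hB.2, union_comm A B] at this
      rw [if_neg hB.1]
      exact_mod_cast this
    have hreal : (∑ B ∈ 𝓛.erase A,
        (#{p ∈ supersetsCard k A ×ˢ supersetsCard k B | t ≤ #(p.1 ∩ p.2)} : ℝ)) ≤
          N * (2 ^ k * M) + M * N := by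
      refine (sum_le_sum hpair).trans ?_
      refine (sum_le_sum_of_subset_of_nonneg (erase_subset A 𝓛) fun B _ _ => ?_).trans ?_
      · refine add_nonneg (sum_nonneg fun P _ => sum_nonneg fun T _ => ?_) (mul_nonneg ?_ ?_)
        · split_ifs <;> positivity
        · split_ifs <;> positivity
        · positivity
      rw [sum_add_distrib, ← sum_mul, sum_comm]
      gcongr
      · rw [← hN A hA, ← nsmul_eq_mul]
        refine sum_le_card_nsmul _ _ _ fun P hP => ?_
        rw [sum_comm]
        refine (sum_le_card_nsmul _ _ M fun T hT => hsum (mem_powersetCard.1 hT).2).trans ?_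
        rw [nsmul_eq_mul, card_powersetCard, (mem_supersetsCard.1 hP).1]
        gcongr
        exact_mod_cast Nat.choose_le_two_pow k t
      · exact hsum (h𝓛 A hA)
    have hsmall : 4 * (N * (2 ^ k * M) + M * N) ≤ (N : ℝ) ^ 2 := by
      calc 4 * (N * (2 ^ k * M) + M * N)
          = (4 * ((2 ^ k + 1) * (2 ^ t * C * (2 * k) ^ t)) * (n : ℝ) ^ (-ε)) * (N : ℝ) ^ 2 := by
            rw [hM]; ring
        _ ≤ 1 * (N : ℝ) ^ 2 := by gcongr; exact hn₁ n ((le_max_left _ _).trans hn)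
        _ = (N : ℝ) ^ 2 := one_mul _
    exact_mod_cast (mul_le_mul_of_nonneg_left hreal (by norm_num : (0 : ℝ) ≤ 4)).trans hsmall
  obtain ⟨f, hf, hfR⟩ := exists_forall_mem_pairwise_not
    (fun A : 𝓛 => supersetsCard k A.1) hNpos (fun A => hN A.1 A.2)
    (fun P Q => t ≤ #(P ∩ Q)) (fun P Q h => by rwa [inter_comm]) fun A => by
      refine le_trans (Nat.mul_le_mul_left 4 (le_of_eq ?_)) (hbad A.1 A.2)
      refine sum_bij (fun B _ => B.1) ?_ ?_ ?_ ?_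
      · intro B hB
        exact mem_erase.2 ⟨fun h => (mem_erase.1 hB).1 (Subtype.ext h), B.2⟩
      · intro B _ B' _ h
        exact Subtype.ext h
      · intro B hB
        rw [mem_erase] at hB
        exact ⟨⟨B, hB.2⟩, mem_erase.2 ⟨fun h => hB.1 (congrArg Subtype.val h), mem_univ _⟩, rfl⟩
      · intro B _
        rfl
  refine ⟨fun A => if h : A ∈ 𝓛 then f ⟨A, h⟩ else ∅, fun A hA => ?_, fun A hA B hB hAB => ?_⟩
  · simpa [hA] using mem_supersetsCard.1 (hf ⟨A, hA⟩)
  · simpa [hA, hB] using hfR ⟨A, hA⟩ ⟨B, hB⟩ fun h => hAB (congrArg Subtype.val h)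
end

section
/- Let n ≥ 3 be an integer and suppose there exists a family 𝓕 of 3-element subsets of an n-element set X such that every 2-element subset of X is contained in exactly one member of 𝓕 (a Steiner triple system). Then n ≡ 1 (mod 6) or n ≡ 3 (mod 6). -/
open Finset

/-- In a Steiner triple system on `X`, the number of points other than `x` is even: they are
paired up by the triples through `x`. -/
theorem card_erase_eq_card_triples_through_mul_two {α : Type*} [DecidableEq α]
    {X : Finset α} {𝓕 : Finset (Finset α)} (h𝓕 : ∀ F ∈ 𝓕, F ⊆ X ∧ F.card = 3)
    (hsts : ∀ A : Finset α, A ⊆ X → A.card = 2 → (𝓕.filter fun F => A ⊆ F).card = 1)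
    {x : α} (hx : x ∈ X) :
    (X.erase x).card = (𝓕.filter fun F => x ∈ F).card * 2 := by
  rw [← mul_one (X.erase x).card]
  refine card_mul_eq_card_mul (fun y F => y ∈ F) (fun y hy => ?_) (fun F hF => ?_)
  · obtain ⟨hyx, hyX⟩ := mem_erase.1 hy
    rw [← hsts {x, y} (by simp [insert_subset_iff, hx, hyX]) (card_pair hyx.symm)]
    congr 1
    ext F
    simp [bipartiteAbove, insert_subset_iff, and_assoc]
  · obtain ⟨hF, hxF⟩ := mem_filter.1 hF
    obtain ⟨hFX, hF3⟩ := h𝓕 F hF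
    have h : (X.erase x).bipartiteBelow (fun y F => y ∈ F) F = F.erase x := by
      ext y
      simp only [bipartiteBelow, mem_filter, mem_erase]
      exact ⟨fun h => ⟨h.1.1, h.2⟩, fun h => ⟨⟨h.1, hFX h.2⟩, h.2⟩⟩
    rw [h, card_erase_of_mem hxF, hF3]

/-- The pairs of points in a Steiner triple system are partitioned by the triples, each of which
contains three pairs. -/
theorem choose_two_eq_card_triples_mul_three {α : Type*} [DecidableEq α]
    {X : Finset α} {𝓕 : Finset (Finset α)} (h𝓕 : ∀ F ∈ 𝓕, F ⊆ X ∧ F.card = 3)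
    (hsts : ∀ A : Finset α, A ⊆ X → A.card = 2 → (𝓕.filter fun F => A ⊆ F).card = 1) :
    X.card.choose 2 = 𝓕.card * 3 := by
  rw [← card_powersetCard, ← mul_one (X.powersetCard 2).card]
  refine card_mul_eq_card_mul (fun A F => A ⊆ F) (fun A hA => ?_) (fun F hF => ?_)
  · obtain ⟨hAX, hA⟩ := mem_powersetCard.1 hA
    exact hsts A hAX hA
  · obtain ⟨hFX, hF3⟩ := h𝓕 F hF
    have h : (X.powersetCard 2).bipartiteBelow (fun A F => A ⊆ F) F = F.powersetCard 2 := by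
      ext A
      simp only [bipartiteBelow, mem_filter, mem_powersetCard]
      exact ⟨fun h => ⟨h.2, h.1.2⟩, fun h => ⟨⟨h.1.trans hFX, h.2⟩, h.1⟩⟩
    rw [h, card_powersetCard, hF3]
    rfl

/-- If a Steiner triple system on `n ≥ 3` vertices exists, then `n ≡ 1` or `n ≡ 3 (mod 6)`. -/
theorem steiner_triple_system_congruence {α : Type*} [DecidableEq α]
    (n : ℕ) (hn : 3 ≤ n)
    (X : Finset α) (hX : X.card = n)
    (𝓕 : Finset (Finset α)) (h𝓕 : ∀ F ∈ 𝓕, F ⊆ X ∧ F.card = 3)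
    (hsts : ∀ A : Finset α, A ⊆ X → A.card = 2 →
      (𝓕.filter fun F => A ⊆ F).card = 1) :
    n % 6 = 1 ∨ n % 6 = 3 := by
  obtain ⟨x, hx⟩ : X.Nonempty := card_pos.1 (by omega)
  have hpoint := card_erase_eq_card_triples_through_mul_two h𝓕 hsts hx
  have hpairs := choose_two_eq_card_triples_mul_three h𝓕 hsts
  rw [card_erase_of_mem hx, hX] at hpoint
  generalize (𝓕.filter fun F => x ∈ F).card = k at hpoint
  obtain rfl : n = 2 * k + 1 := by omega
  have hprod : (2 * k + 1) * k = 𝓕.card * 3 := by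
    rw [← hpairs, hX, Nat.choose_two_right, Nat.add_sub_cancel, mul_left_comm,
      Nat.mul_div_cancel_left _ two_pos]
  have hmod : (2 * k + 1) * k % 3 = 0 := by omega
  have hk : k % 3 = 0 ∨ k % 3 = 1 ∨ k % 3 = 2 := by omega
  rcases hk with hk | hk | hk
  · omega
  · omega
  · simp [Nat.mul_mod, Nat.add_mod, hk] at hmod
end
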